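/- arXiv:2301.07872 — 3 statements merged into one kernel-verified Lean document; each statement's English description precedes it below -/
import Mathlib

section
/- Let V be a connected scheme of finite type over ℂ with trivial étale fundamental group, i.e., every finite étale surjective morphism W → V with W connected is an isomorphism. Then the Picard group Pic(V) (isomorphism classes of invertible O_V-modules under tensor product) is torsion-free. -/
noncomputable section

open CategoryTheory AlgebraicGeometry MonoidalCategory

/-- The tensor product of two sheaves of `O_X`-modules on a scheme `X`: the sheafification of
the (presheaf-level) tensor product. -/
def sheafTensor (X : Scheme.{0}) (L M : X.Modules) : X.Modules :=
  let L' : PresheafOfModules.{0} (X.sheaf.val ⋙ forget₂ CommRingCat RingCat) := L.val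
  let M' : PresheafOfModules.{0} (X.sheaf.val ⋙ forget₂ CommRingCat RingCat) := M.val
  let T : PresheafOfModules.{0} (X.sheaf.val ⋙ forget₂ CommRingCat RingCat) := tensorObj L' M'
  (PresheafOfModules.sheafification (𝟙 X.ringCatSheaf.val)).obj T

/-- The `ℓ`-th tensor power of a sheaf of `O_X`-modules, with the structure sheaf (the unit
`O_X`-module) as the zeroth power. -/
def sheafPow (X : Scheme.{0}) (L : X.Modules) : ℕ → X.Modules
  | 0 => SheafOfModules.unit X.ringCatSheaf
  | k + 1 => sheafTensor X (sheafPow X L k) L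

/-- An `O_X`-module is invertible if it has an inverse with respect to the tensor product of
`O_X`-modules, the unit being the structure sheaf. -/
def IsInvertibleSheaf (X : Scheme.{0}) (L : X.Modules) : Prop :=
  ∃ M : X.Modules, Nonempty (sheafTensor X L M ≅ SheafOfModules.unit X.ringCatSheaf)


section
open TensorProduct Opposite

def tensEta (X : Scheme.{0}) (L M : X.Modules) (U : X.Opens) :
    (Γ(L, U) ⊗[Γ(X, U)] Γ(M, U)) →ₗ[Γ(X, U)] Γ(sheafTensor X L M, U) := by
  let L' : PresheafOfModules.{0} (X.sheaf.val ⋙ forget₂ CommRingCat RingCat) := L.val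
  let M' : PresheafOfModules.{0} (X.sheaf.val ⋙ forget₂ CommRingCat RingCat) := M.val
  let T : PresheafOfModules.{0} (X.sheaf.val ⋙ forget₂ CommRingCat RingCat) := tensorObj L' M'
  exact (((PresheafOfModules.sheafificationAdjunction (𝟙 X.ringCatSheaf.val)).unit.app T).app (op U)).hom

theorem tensEta_map (X : Scheme.{0}) (L M : X.Modules) {U V : X.Opens} (i : V ⟶ U)
    (a : Γ(L, U)) (b : Γ(M, U)) :
    (sheafTensor X L M).presheaf.map i.op (tensEta X L M U (a ⊗ₜ b)) =
      tensEta X L M V (L.presheaf.map i.op a ⊗ₜ M.presheaf.map i.op b) := by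
  let L' : PresheafOfModules.{0} (X.sheaf.val ⋙ forget₂ CommRingCat RingCat) := L.val
  let M' : PresheafOfModules.{0} (X.sheaf.val ⋙ forget₂ CommRingCat RingCat) := M.val
  let T : PresheafOfModules.{0} (X.sheaf.val ⋙ forget₂ CommRingCat RingCat) := tensorObj L' M'
  exact (PresheafOfModules.naturality_apply
    ((PresheafOfModules.sheafificationAdjunction (𝟙 X.ringCatSheaf.val)).unit.app T) i.op
      (show Γ(L, U) ⊗[Γ(X, U)] Γ(M, U) from a ⊗ₜ[Γ(X, U)] b)).symm

theorem tensEta_surj (X : Scheme.{0}) (L M : X.Modules) (U : X.Opens) (y : Γ(sheafTensor X L M, U))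
    (x : X) (hx : x ∈ U) : ∃ (V : X.Opens) (i : V ⟶ U), x ∈ V ∧
      ∃ t, tensEta X L M V t = (sheafTensor X L M).presheaf.map i.op y := by
  let L' : PresheafOfModules.{0} (X.sheaf.val ⋙ forget₂ CommRingCat RingCat) := L.val
  let M' : PresheafOfModules.{0} (X.sheaf.val ⋙ forget₂ CommRingCat RingCat) := M.val
  let T : PresheafOfModules.{0} (X.sheaf.val ⋙ forget₂ CommRingCat RingCat) := tensorObj L' M'
  have := Presheaf.imageSieve_mem (Opens.grothendieckTopology X)
    (CategoryTheory.toSheafify (Opens.grothendieckTopology X) T.presheaf) (U := op U) y x hx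
  obtain ⟨V, i, ⟨t, ht⟩, hxV⟩ := this
  exact ⟨V, i, hxV, t, ht⟩

theorem tensEta_inj (X : Scheme.{0}) (L M : X.Modules) (U : X.Opens) 
    (a : Γ(L, U)) (b : Γ(M, U)) (h : tensEta X L M U (a ⊗ₜ b) = 0)
    (x : X) (hx : x ∈ U) : ∃ (V : X.Opens) (i : V ⟶ U), x ∈ V ∧
      L.presheaf.map i.op a ⊗ₜ[Γ(X, V)] M.presheaf.map i.op b = 0 := by
  let L' : PresheafOfModules.{0} (X.sheaf.val ⋙ forget₂ CommRingCat RingCat) := L.val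
  let M' : PresheafOfModules.{0} (X.sheaf.val ⋙ forget₂ CommRingCat RingCat) := M.val
  let T : PresheafOfModules.{0} (X.sheaf.val ⋙ forget₂ CommRingCat RingCat) := tensorObj L' M'
  have := Presheaf.equalizerSieve_mem (Opens.grothendieckTopology X)
    (CategoryTheory.toSheafify (Opens.grothendieckTopology X) T.presheaf) (X := op U)
    (show Γ(L, U) ⊗[Γ(X, U)] Γ(M, U) from a ⊗ₜ[Γ(X, U)] b)
    (show Γ(L, U) ⊗[Γ(X, U)] Γ(M, U) from 0)
    (by
      refine Eq.trans h (Eq.symm ?_)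
      exact map_zero (tensEta X L M U)) x hx
  obtain ⟨V, i, ht, hxV⟩ := this
  refine ⟨V, i, hxV, ?_⟩
  exact Eq.trans ht (map_zero (T.presheaf.map i.op).hom)


def rs {X : Scheme.{0}} (M : X.Modules) {U V : X.Opens} (h : V ≤ U) : Γ(M, U) →+ Γ(M, V) :=
  (M.presheaf.map (homOfLE h).op).hom

def rr {X : Scheme.{0}} {U V : X.Opens} (h : V ≤ U) : Γ(X, U) →+* Γ(X, V) :=
  (X.presheaf.map (homOfLE h).op).hom

theorem rs_rs {X : Scheme.{0}} (M : X.Modules) {U V W : X.Opens} (h : V ≤ U) (h' : W ≤ V)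
    (x : Γ(M, U)) : rs M h' (rs M h x) = rs M (h'.trans h) x := by
  unfold rs
  rw [← AddCommGrpCat.comp_apply, ← Functor.map_comp]; rfl

theorem rs_self {X : Scheme.{0}} (M : X.Modules) {U : X.Opens} (h : U ≤ U)
    (x : Γ(M, U)) : rs M h x = x := by
  simp [rs]

theorem rr_rr {X : Scheme.{0}} {U V W : X.Opens} (h : V ≤ U) (h' : W ≤ V)
    (x : Γ(X, U)) : rr h' (rr h x) = rr (h'.trans h) x := by
  unfold rr
  rw [← CommRingCat.comp_apply, ← Functor.map_comp]; rfl

theorem rr_self {X : Scheme.{0}} {U : X.Opens} (h : U ≤ U)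
    (x : Γ(X, U)) : rr h x = x := by
  simp [rr]

theorem rs_smul {X : Scheme.{0}} (M : X.Modules) {U V : X.Opens} (h : V ≤ U) (a : Γ(X, U))
    (x : Γ(M, U)) : rs M h (a • x) = rr h a • rs M h x :=
  Scheme.Modules.map_smul M (homOfLE h) a x

theorem rs_ext {X : Scheme.{0}} (M : X.Modules) {U : X.Opens} (a b : Γ(M, U))
    (H : ∀ x ∈ U, ∃ (V : X.Opens) (h : V ≤ U), x ∈ V ∧ rs M h a = rs M h b) : a = b := by
  choose! V h hx hV using H
  refine TopCat.Sheaf.eq_of_locally_eq' (⟨M.presheaf, M.isSheaf⟩ : TopCat.Sheaf Ab X)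
    (fun x : U => V x.1) U (fun x => homOfLE (h x.1 x.2)) ?_ a b ?_
  · intro x hxU
    exact TopologicalSpace.Opens.mem_iSup.2 ⟨⟨x, hxU⟩, hx x hxU⟩
  · intro i
    exact hV i.1 i.2

theorem rr_ext {X : Scheme.{0}} {U : X.Opens} (a b : Γ(X, U))
    (H : ∀ x ∈ U, ∃ (V : X.Opens) (h : V ≤ U), x ∈ V ∧ rr h a = rr h b) : a = b := by
  choose! V h hx hV using H
  refine TopCat.Sheaf.eq_of_locally_eq' X.sheaf
    (fun x : U => V x.1) U (fun x => homOfLE (h x.1 x.2)) ?_ a b ?_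
  · intro x hxU
    exact TopologicalSpace.Opens.mem_iSup.2 ⟨⟨x, hxU⟩, hx x hxU⟩
  · intro i
    exact hV i.1 i.2

theorem rs_glue {X : Scheme.{0}} (M : X.Modules) {I : Type} (U : I → X.Opens)
    (hU : ∀ x, ∃ i, x ∈ U i) (s : ∀ i, Γ(M, U i))
    (H : ∀ i j, ∀ x ∈ U i, x ∈ U j → ∃ (V : X.Opens) (h : V ≤ U i) (h' : V ≤ U j), x ∈ V ∧
      rs M h (s i) = rs M h' (s j)) :
    ∃ e : Γ(M, ⊤), ∀ i, rs M le_top e = s i := by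
  obtain ⟨e, he, -⟩ := TopCat.Sheaf.existsUnique_gluing'
    (⟨M.presheaf, M.isSheaf⟩ : TopCat.Sheaf Ab X) U ⊤ (fun i => homOfLE le_top) (by
      intro x _
      exact TopologicalSpace.Opens.mem_iSup.2 (hU x)) s (by
      intro i j
      change rs M _ (s i) = rs M _ (s j)
      apply rs_ext
      intro x hx
      obtain ⟨V, h, h', hxV, hV⟩ := H i j x hx.1 hx.2
      refine ⟨V, le_inf h h', hxV, ?_⟩
      rw [rs_rs, rs_rs]
      exact hV)
  exact ⟨e, he⟩

def OX (X : Scheme.{0}) : X.Modules := SheafOfModules.unit X.ringCatSheaf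

/-- evaluation attached to an isomorphism with the unit -/
def ev {X : Scheme.{0}} {P : X.Modules} (φ : P ≅ OX X)
    (U : X.Opens) : Γ(P, U) →ₗ[Γ(X, U)] Γ(X, U) := (φ.hom.val.app (op U)).hom

theorem ev_bij {X : Scheme.{0}} {P : X.Modules}
    (φ : P ≅ OX X) (U : X.Opens) :
    Function.Bijective (ev φ U) := by
  have : IsIso (φ.hom.app U) := inferInstance
  exact ConcreteCategory.bijective_of_isIso (φ.hom.app U)

theorem ev_rs {X : Scheme.{0}} {P : X.Modules}
    (φ : P ≅ OX X) {U V : X.Opens} (h : V ≤ U)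
    (x : Γ(P, U)) : rr h (ev φ U x) = ev φ V (rs P h x) :=
  (PresheafOfModules.naturality_apply φ.hom.val (homOfLE h).op x).symm

def IsGen {X : Scheme.{0}} (L : X.Modules) {U : X.Opens} (s : Γ(L, U)) : Prop :=
  ∀ (V : X.Opens) (h : V ≤ U), Function.Bijective (fun a : Γ(X, V) => a • rs L h s)

theorem IsGen.rs {X : Scheme.{0}} {L : X.Modules} {U V : X.Opens} {s : Γ(L, U)} (hs : IsGen L s)
    (h : V ≤ U) : IsGen L (rs L h s) := by
  intro W hW
  simpa [rs_rs] using hs W (hW.trans h)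

theorem iso_of_gen {X : Scheme.{0}} (L : X.Modules) (e : Γ(L, ⊤)) (he : IsGen L e) :
    Nonempty (L ≅ OX X) := by
  let σ : SheafOfModules.sections L := PresheafOfModules.sectionsMk (fun U => rs L (le_top : U.unop ≤ ⊤) e) (by
    intro U V f
    exact rs_rs L le_top f.unop.le e)
  let f : OX X ⟶ L :=
    (SheafOfModules.unitHomEquiv (R := X.ringCatSheaf) L).symm σ
  have hf : ∀ (U : X.Opens) (a : Γ(X, U)), f.app U a = a • rs L (le_top : U ≤ ⊤) e := by
    intro U a
    have h1 : f.app U (1 : Γ(X, U)) = rs L (le_top : U ≤ ⊤) e := by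
      have := SheafOfModules.unitHomEquiv_apply_coe L ((SheafOfModules.unitHomEquiv (R := X.ringCatSheaf) L).symm σ) (op U)
      rw [Equiv.apply_symm_apply] at this
      exact this.symm
    rw [← h1]
    refine Eq.trans ?_ (Scheme.Modules.Hom.app_smul f a (show Γ(OX X, U) from (1 : Γ(X, U))))
    exact congrArg (f.app U) (mul_one a).symm
  have : IsIso f := by
    rw [Scheme.Modules.Hom.isIso_iff_isIso_app]
    intro U
    rw [ConcreteCategory.isIso_iff_bijective]
    have := he U le_top
    rw [← funext (hf U)] at this
    exact this
  exact ⟨(asIso f).symm⟩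

theorem isGen_of_local {X : Scheme.{0}} (L : X.Modules) {U : X.Opens} (e : Γ(L, U))
    (H : ∀ x ∈ U, ∃ (V : X.Opens) (h : V ≤ U), x ∈ V ∧ IsGen L (rs L h e)) : IsGen L e := by
  intro W hW
  constructor
  · intro a b hab
    apply rr_ext
    intro x hx
    obtain ⟨V, h, hxV, hV⟩ := H x (hW hx)
    refine ⟨V ⊓ W, inf_le_right, ⟨hxV, hx⟩, ?_⟩
    apply (hV (V ⊓ W) inf_le_left).1
    have := congrArg (rs L (inf_le_right : V ⊓ W ≤ W)) hab
    simpa [rs_smul, rs_rs] using this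
  · intro y
    choose! V h hxV hV using H
    let A : W → X.Opens := fun x => V x.1 ⊓ W
    have hA : ∀ x : W, A x ≤ W := fun x => inf_le_right
    have hex : ∀ x : W, ∃ a : Γ(X, A x), a • rs L ((hA x).trans hW) e = rs L (hA x) y := by
      intro x
      obtain ⟨a, ha⟩ := (hV x.1 (hW x.2) (A x) inf_le_left).2 (rs L (hA x) y)
      exact ⟨a, by simpa [rs_rs] using ha⟩
    choose a ha using hex
    have hg := TopCat.Sheaf.existsUnique_gluing' X.sheaf A W (fun i => homOfLE (hA i)) (by
      intro x hx
      exact TopologicalSpace.Opens.mem_iSup.2 ⟨⟨x, hx⟩, hxV x (hW hx), hx⟩) a (by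
      intro i j
      have hl : A i ⊓ A j ≤ A i := inf_le_left
      have hr : A i ⊓ A j ≤ A j := inf_le_right
      change rr hl (a i) = rr hr (a j)
      apply (hV i.1 (hW i.2) (A i ⊓ A j) (hl.trans inf_le_left)).1
      have h1 := congrArg (rs L hl) (ha i)
      have h2 := congrArg (rs L hr) (ha j)
      simp only [rs_smul, rs_rs] at h1 h2 ⊢
      rw [h1, h2])
    have hg' : ∃ b : Γ(X, W), ∀ x, rr (hA x) b = a x := ⟨hg.choose, hg.choose_spec.1⟩
    obtain ⟨b, hb⟩ := hg'
    refine ⟨b, ?_⟩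
    apply rs_ext
    intro x hx
    refine ⟨A ⟨x, hx⟩, hA _, ⟨hxV x (hW hx), hx⟩, ?_⟩
    have hb' : rr (hA ⟨x, hx⟩) b = a ⟨x, hx⟩ := hb ⟨x, hx⟩
    simp only [rs_smul, rs_rs]
    rw [hb', ha]


theorem tensEta_rs (X : Scheme.{0}) (L M : X.Modules) {U V : X.Opens} (h : V ≤ U)
    (a : Γ(L, U)) (b : Γ(M, U)) :
    rs (sheafTensor X L M) h (tensEta X L M U (a ⊗ₜ b)) =
      tensEta X L M V (rs L h a ⊗ₜ rs M h b) := tensEta_map X L M (homOfLE h) a b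

theorem exists_gen {X : Scheme.{0}} (L : X.Modules) (hL : IsInvertibleSheaf X L) (x : X) :
    ∃ (U : X.Opens) (s : Γ(L, U)), x ∈ U ∧ IsGen L s := by
  obtain ⟨M, ⟨ψ'⟩⟩ := hL
  let ψ : sheafTensor X L M ≅ OX X := ψ'
  let B : ∀ U : X.Opens, (Γ(L, U) ⊗[Γ(X, U)] Γ(M, U)) →ₗ[Γ(X, U)] Γ(X, U) :=
    fun U => (ev ψ U).comp (tensEta X L M U)
  have hBr : ∀ {U V : X.Opens} (h : V ≤ U) (a : Γ(L, U)) (b : Γ(M, U)),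
      rr h (B U (a ⊗ₜ b)) = B V (rs L h a ⊗ₜ rs M h b) := by
    intro U V h a b
    simp only [B, LinearMap.comp_apply]
    rw [ev_rs, tensEta_rs]
  obtain ⟨y, hy⟩ := (ev_bij ψ ⊤).2 1
  obtain ⟨V, i, hxV, t, ht⟩ := tensEta_surj X L M ⊤ y x trivial
  have ht1 : B V t = 1 := by
    have : B V t = ev ψ V (rs _ i.le y) := congrArg (ev ψ V) ht
    rw [this, ← ev_rs, hy, map_one]
  have key : ∃ (a : Γ(L, V)) (b : Γ(M, V)), x ∈ X.basicOpen (B V (a ⊗ₜ b)) := by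
    by_contra! hcon
    have : ∀ t, (X.presheaf.germ V x hxV) (B V t) ∈ IsLocalRing.maximalIdeal (X.presheaf.stalk x) := by
      intro t
      induction t with
      | zero => simp
      | tmul a b =>
        have := hcon a b
        rw [Scheme.mem_basicOpen _ _ _ hxV] at this
        exact this
      | add a b ha hb =>
        rw [map_add, map_add]; exact Ideal.add_mem _ ha hb
    have h1 := this t
    rw [ht1, map_one] at h1
    exact (Ideal.ne_top_iff_one _).1 (IsLocalRing.maximalIdeal.isMaximal _).ne_top h1
  obtain ⟨a, b, hxU⟩ := key
  set f := B V (a ⊗ₜ b) with hf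
  obtain ⟨U, hUV, hxU, u, hu⟩ : ∃ (U : X.Opens) (h : U ≤ V), x ∈ U ∧ IsUnit (rr h f) :=
    ⟨X.basicOpen f, X.basicOpen_le f, hxU, RingedSpace.isUnit_res_basicOpen _ f⟩
  let s : Γ(L, U) := (↑u⁻¹ : Γ(X, U)) • rs L hUV a
  let c : Γ(M, U) := rs M hUV b
  have hsc : B U (s ⊗ₜ c) = 1 := by
    simp only [s, c, ← TensorProduct.smul_tmul', map_smul]
    rw [← hBr, ← hf, ← hu]
    simp
  have hsc' : ∀ (W : X.Opens) (h : W ≤ U), B W (rs L h s ⊗ₜ rs M h c) = 1 := by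
    intro W h
    rw [← hBr, hsc, map_one]
  refine ⟨U, s, hxU, ?_⟩
  intro W hW
  constructor
  · intro r r' hrr
    have := congrArg (fun z => B W (z ⊗ₜ rs M hW c)) hrr
    simpa only [← TensorProduct.smul_tmul', map_smul, hsc', smul_eq_mul, mul_one] using this
  · intro y
    refine ⟨B W (y ⊗ₜ rs M hW c), ?_⟩
    set r := B W (y ⊗ₜ rs M hW c) with hr
    suffices y - r • rs L hW s = 0 from (sub_eq_zero.1 this).symm
    set z := y - r • rs L hW s with hz
    have hz0 : tensEta X L M W (z ⊗ₜ rs M hW c) = 0 := by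
      apply (ev_bij ψ W).1
      change B W _ = _
      rw [map_zero, hz, TensorProduct.sub_tmul, map_sub, ← TensorProduct.smul_tmul', map_smul, hsc',
        ← hr]
      simp
    apply rs_ext
    intro x' hx'
    obtain ⟨W', j, hxW', h0⟩ := tensEta_inj X L M W z _ hz0 x' hx'
    have h0' : rs L j.le z ⊗ₜ[Γ(X, W')] rs M j.le (rs M hW c) = 0 := h0
    refine ⟨W', j.le, hxW', ?_⟩
    have hW' : W' ≤ U := j.le.trans hW
    let Λ : (Γ(L, W') ⊗[Γ(X, W')] Γ(M, W')) →ₗ[Γ(X, W')] Γ(L, W') :=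
      TensorProduct.lift (LinearMap.mk₂ Γ(X, W')
        (fun l m => B W' (rs L hW' s ⊗ₜ m) • l)
        (fun _ _ _ => smul_add _ _ _)
        (fun _ _ _ => smul_comm _ _ _)
        (fun _ _ _ => by rw [TensorProduct.tmul_add, map_add, add_smul])
        (fun _ _ _ => by rw [TensorProduct.tmul_smul, map_smul, smul_assoc]))
    have := congrArg Λ h0'
    rw [map_zero, rs_rs] at this
    rw [map_zero]
    simpa [Λ, hsc'] using this

def tE {X : Scheme.{0}} (L : X.Modules) (k : ℕ) (U : X.Opens) :
    (Γ(sheafPow X L k, U) ⊗[Γ(X, U)] Γ(L, U)) →ₗ[Γ(X, U)] Γ(sheafPow X L (k + 1), U) :=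
  tensEta X (sheafPow X L k) L U

theorem tE_rs {X : Scheme.{0}} (L : X.Modules) (k : ℕ) {U V : X.Opens} (h : V ≤ U)
    (a : Γ(sheafPow X L k, U)) (b : Γ(L, U)) :
    rs (sheafPow X L (k + 1)) h (tE L k U (a ⊗ₜ b)) = tE L k V (rs _ h a ⊗ₜ rs L h b) :=
  tensEta_map X (sheafPow X L k) L (homOfLE h) a b

theorem tE_surj {X : Scheme.{0}} (L : X.Modules) (k : ℕ) (U : X.Opens)
    (y : Γ(sheafPow X L (k + 1), U))
    (x : X) (hx : x ∈ U) : ∃ (V : X.Opens) (i : V ≤ U), x ∈ V ∧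
      ∃ t, tE L k V t = rs (sheafPow X L (k + 1)) i y := by
  obtain ⟨V, i, h, t, ht⟩ := tensEta_surj X (sheafPow X L k) L U y x hx
  exact ⟨V, i.le, h, t, ht⟩

def pw {X : Scheme.{0}} (L : X.Modules) {U : X.Opens} (s : Γ(L, U)) : ∀ k, Γ(sheafPow X L k, U)
  | 0 => (1 : Γ(X, U))
  | k + 1 => tE L k U (pw L s k ⊗ₜ s)

theorem pw_rs {X : Scheme.{0}} (L : X.Modules) {U V : X.Opens} (h : V ≤ U) (s : Γ(L, U)) (k : ℕ) :
    rs _ h (pw L s k) = pw L (rs L h s) k := by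
  induction k with
  | zero => exact map_one (rr h)
  | succ k ih =>
    refine (tE_rs L k h _ _).trans ?_
    rw [ih]; rfl

theorem pw_smul {X : Scheme.{0}} (L : X.Modules) {U : X.Opens} (g : Γ(X, U)) (s : Γ(L, U)) (k : ℕ) :
    pw L (g • s) k = g ^ k • pw L s k := by
  induction k with
  | zero => rw [pow_zero, one_smul]; rfl
  | succ k ih =>
    have : pw L (g • s) (k + 1) = tE L k U (pw L (g • s) k ⊗ₜ (g • s)) := rfl
    rw [this, ih, TensorProduct.tmul_smul, ← TensorProduct.smul_tmul', map_smul, map_smul,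
      smul_smul, ← pow_succ']
    rfl

theorem pw_locgen {X : Scheme.{0}} (L : X.Modules) {U : X.Opens} (s : Γ(L, U)) (hs : IsGen L s)
    (k : ℕ) (V : X.Opens) (h : V ≤ U) (y : Γ(sheafPow X L k, V)) (x : X) (hx : x ∈ V) :
    ∃ (W : X.Opens) (h' : W ≤ V), x ∈ W ∧ ∃ a : Γ(X, W), rs _ h' y = a • pw L (rs L (h'.trans h) s) k := by
  induction k generalizing V with
  | zero =>
    refine ⟨V, le_rfl, hx, (show Γ(X, V) from y), ?_⟩
    rw [rs_self]
    exact (mul_one (show Γ(X, V) from y)).symm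
  | succ k ih =>
    obtain ⟨W, i, hxW, t, ht⟩ := tE_surj L k V y x hx
    have ht' : tE L k W t = rs (sheafPow X L (k+1)) i y := ht
    suffices ∀ t : Γ(sheafPow X L k, W) ⊗[Γ(X, W)] Γ(L, W), ∃ (W' : X.Opens) (h' : W' ≤ W), x ∈ W' ∧ ∃ a : Γ(X, W'),
        rs (sheafPow X L (k+1)) h' (tE L k W t) =
          a • pw L (rs L (h'.trans (i.trans h)) s) (k+1) by
      obtain ⟨W', h', hxW', a, ha⟩ := this t
      refine ⟨W', h'.trans i, hxW', a, ?_⟩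
      rw [← ha, ht', rs_rs]
    clear ht' ht t
    intro t
    induction t with
    | zero => refine ⟨W, le_rfl, hxW, 0, ?_⟩; simp
    | tmul p l =>
      obtain ⟨W', h', hxW', a, ha⟩ := ih W (i.trans h) p hxW
      obtain ⟨b, hb⟩ := (hs W' (h'.trans (i.trans h))).2 (rs L h' l)
      dsimp only at hb
      refine ⟨W', h', hxW', b * a, ?_⟩
      refine (tE_rs L k h' _ _).trans ?_
      rw [ha, ← hb, TensorProduct.tmul_smul, ← TensorProduct.smul_tmul', map_smul, map_smul, smul_smul]
      rfl
    | add t t' h1 h2 =>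
      obtain ⟨W1, l1, x1, a1, e1⟩ := h1
      obtain ⟨W2, l2, x2, a2, e2⟩ := h2
      refine ⟨W1 ⊓ W2, inf_le_left.trans l1, ⟨x1, x2⟩, rr inf_le_left a1 + rr inf_le_right a2, ?_⟩
      have f1 := congrArg (rs (sheafPow X L (k+1)) (inf_le_left : W1 ⊓ W2 ≤ W1)) e1
      have f2 := congrArg (rs (sheafPow X L (k+1)) (inf_le_right : W1 ⊓ W2 ≤ W2)) e2
      rw [rs_smul, pw_rs, rs_rs, rs_rs] at f1 f2
      rw [add_smul, ← f1, ← f2, map_add, map_add]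

theorem isUnit_of_local {X : Scheme.{0}} {U : X.Opens} (f : Γ(X, U))
    (H : ∀ x ∈ U, ∃ (V : X.Opens) (h : V ≤ U), x ∈ V ∧ IsUnit (rr h f)) : IsUnit f := by
  apply RingedSpace.isUnit_of_isUnit_germ
  intro x hx
  obtain ⟨V, h, hxV, hV⟩ := H x hx
  have := hV.map (X.presheaf.germ V x hxV).hom
  rw [show (X.presheaf.germ V x hxV).hom (rr h f) = X.presheaf.germ U x hx f from
    TopCat.Presheaf.germ_res_apply _ (homOfLE h) x hxV f] at this
  exact this

theorem pw_unit {X : Scheme.{0}} (L : X.Modules) {U : X.Opens} (s : Γ(L, U)) (hs : IsGen L s)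
    (k : ℕ) (φ : sheafPow X L k ≅ OX X) : IsUnit (ev φ U (pw L s k)) := by
  apply isUnit_of_local
  intro x hx
  obtain ⟨y, hy⟩ := (ev_bij φ U).2 1
  obtain ⟨W, h', hxW, a, ha⟩ := pw_locgen L s hs k U le_rfl y x hx
  refine ⟨W, h', hxW, ?_⟩
  have := congrArg (ev φ W) ha
  rw [← ev_rs, hy, map_one, map_smul, ← pw_rs, ← ev_rs] at this
  exact IsUnit.of_mul_eq_one_right a this.symm


open Polynomial in
abbrev kum {R : Type} [CommRing R] (l : ℕ) (u : R) : Type := AdjoinRoot (X ^ l - C u : R[X])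

open Polynomial in
theorem kum_monic {R : Type} [CommRing R] {l : ℕ} (hl : 1 ≤ l) (u : R) :
    (X ^ l - C u : R[X]).Monic := monic_X_pow_sub_C u (by omega)

theorem kum_root {R : Type} [CommRing R] {l : ℕ} (u : R) :
    (AdjoinRoot.root _ : kum l u) ^ l = AdjoinRoot.of _ u := by
  have := AdjoinRoot.eval₂_root (Polynomial.X ^ l - Polynomial.C u : Polynomial R)
  simpa [sub_eq_zero] using this

theorem kum_finite {R : Type} [CommRing R] {l : ℕ} (hl : 1 ≤ l) (u : R) :
    Module.Finite R (kum l u) := (kum_monic hl u).finite_adjoinRoot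

theorem kum_nontriv {R : Type} [CommRing R] [Nontrivial R] {l : ℕ} (hl : 1 ≤ l) (u : R) :
    Nontrivial (kum l u) := by
  refine Ideal.Quotient.nontrivial_iff.2 fun h => ?_
  rw [Ideal.span_singleton_eq_top] at h
  have h1 : (Polynomial.X ^ l - Polynomial.C u : Polynomial R) = 1 :=
    (kum_monic hl u).eq_one_of_isUnit h
  have h2 := congrArg Polynomial.natDegree h1
  rw [Polynomial.natDegree_X_pow_sub_C, Polynomial.natDegree_one] at h2
  omega

open Polynomial in
theorem kum_etale {R : Type} [CommRing R] {l : ℕ} (hl : 1 ≤ l) (u : R) (hu : IsUnit u)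
    (h : IsUnit (l : R)) : Algebra.Etale R (kum l u) := by
  obtain ⟨v, hv⟩ := hu.exists_right_inv
  obtain ⟨m, hm⟩ := h.exists_right_inv
  let P : StandardEtalePair R :=
    { f := X ^ l - C u
      monic_f := kum_monic hl u
      g := 1
      cond := ⟨C m * C v * X, - C v, 1, by
        obtain ⟨k, rfl⟩ : ∃ k, l = k + 1 := ⟨l - 1, by omega⟩
        have hv' : (C u * C v : R[X]) = 1 := by rw [← C_mul, hv, C_1]
        have hm' : ((k + 1 : R[X]) * C m : R[X]) = 1 := by
          have : (k + 1 : R[X]) = C ((k + 1 : ℕ) : R) := by simp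
          rw [this, ← C_mul, hm, C_1]
        simp only [derivative_sub, derivative_X_pow, derivative_C, sub_zero, Nat.add_sub_cancel]
        push_cast
        simp only [map_add, map_one, map_natCast]
        linear_combination (C v * X ^ (k + 1)) * hm' + hv'⟩ }
  have e1 : P.Ring ≃ₐ[R] Localization.Away (AdjoinRoot.mk P.f P.g) := P.equivAwayAdjoinRoot
  have hone : IsUnit (AdjoinRoot.mk P.f P.g) := by simp [P]
  have e2 : AdjoinRoot P.f ≃ₐ[AdjoinRoot P.f] Localization.Away (AdjoinRoot.mk P.f P.g) :=
    IsLocalization.atUnit _ _ _ hone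
  exact Algebra.Etale.of_equiv (e1.trans (e2.restrictScalars R).symm)


theorem exists_min_clopen {T : Type} [TopologicalSpace T] [TopologicalSpace.NoetherianSpace T]
    (x : T) : ∃ Z : Set T, IsClopen Z ∧ x ∈ Z ∧ ∀ Z' : Set T, IsClopen Z' → x ∈ Z' → Z' ⊆ Z → Z' = Z := by
  have wf : WellFoundedLT (TopologicalSpace.Closeds T) := inferInstance
  obtain ⟨Z, ⟨h1, h2⟩, hmin⟩ := wf.wf.has_min {Z : TopologicalSpace.Closeds T | IsOpen (Z : Set T) ∧ x ∈ Z}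
    ⟨⊤, isOpen_univ, Set.mem_univ x⟩
  refine ⟨Z, ⟨Z.isClosed, h1⟩, h2, fun Z' hZ' hx hs => ?_⟩
  by_contra hne
  refine hmin ⟨Z', hZ'.1⟩ ⟨hZ'.2, hx⟩ ?_
  exact lt_of_le_of_ne hs (fun h => hne (congrArg SetLike.coe h))

theorem exists_conn_clopen {T : Type} [TopologicalSpace T] [TopologicalSpace.NoetherianSpace T]
    (x : T) : ∃ Z : Set T, IsClopen Z ∧ x ∈ Z ∧ ConnectedSpace Z := by
  obtain ⟨Z, hZ, hx, hmin⟩ := exists_min_clopen x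
  refine ⟨Z, hZ, hx, ?_⟩
  have key : ∀ s : Set Z, IsClopen s → (⟨x, hx⟩ : Z) ∈ s → s = Set.univ := by
    intro s hs hxs
    have h1 : IsClopen (Subtype.val '' s) :=
      ⟨hZ.1.isClosedEmbedding_subtypeVal.isClosedMap _ hs.1,
        hZ.2.isOpenEmbedding_subtypeVal.isOpenMap _ hs.2⟩
    have := hmin _ h1 ⟨_, hxs, rfl⟩ (by rintro _ ⟨y, _, rfl⟩; exact y.2)
    ext y
    simp only [Set.mem_univ, iff_true]
    have hy : (y : T) ∈ Subtype.val '' s := by rw [this]; exact y.2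
    obtain ⟨z, hz, hzy⟩ := hy
    rwa [← Subtype.ext hzy]
  have : PreconnectedSpace Z := by
    rw [preconnectedSpace_iff_clopen]
    intro s hs
    by_cases h : (⟨x, hx⟩ : Z) ∈ s
    · exact Or.inr (key s hs h)
    · left
      have := key sᶜ hs.compl h
      simpa using this
  exact { toNonempty := ⟨⟨x, hx⟩⟩ }

theorem exists_section (V : Scheme.{0}) (hconn : ConnectedSpace V)
    (p : V ⟶ Spec (CommRingCat.of ℂ)) (hft : LocallyOfFiniteType p) (hqc : QuasiCompact p)
    (hpi1 : ∀ (W : Scheme.{0}) (q : W ⟶ V), ConnectedSpace W → IsFinite q → Etale q →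
      AlgebraicGeometry.Surjective q → IsIso q)
    (W : Scheme.{0}) (q : W ⟶ V) (hq : IsFinite q) (hq' : Etale q) (hne : Nonempty W) :
    ∃ σ : V ⟶ W, σ ≫ q = 𝟙 V := by
  have : IsLocallyNoetherian W := LocallyOfFiniteType.isLocallyNoetherian (q ≫ p)
  have : CompactSpace W := QuasiCompact.compactSpace_of_compactSpace (q ≫ p)
  have : IsNoetherian W := {}
  obtain ⟨x⟩ := hne
  obtain ⟨Z, hZ, hx, hZc⟩ := exists_conn_clopen x
  let U : W.Opens := ⟨Z, hZ.2⟩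
  have hcl : IsClosedImmersion U.ι := by
    apply IsClosedImmersion.of_isPreimmersion
    rw [Scheme.Opens.range_ι]
    exact hZ.1
  have hcon : ConnectedSpace U := hZc
  have hsurj : AlgebraicGeometry.Surjective (U.ι ≫ q) := by
    refine ⟨?_⟩
    rw [← Set.range_eq_univ]
    refine IsClopen.eq_univ ⟨?_, ?_⟩ ⟨_, ⟨⟨x, hx⟩, rfl⟩⟩
    · exact (U.ι ≫ q).isClosedMap.isClosed_range
    · exact (U.ι ≫ q).isOpenMap.isOpen_range
  have := hpi1 U (U.ι ≫ q) hcon inferInstance inferInstance hsurj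
  exact ⟨inv (U.ι ≫ q) ≫ U.ι, by simp⟩


/-- Data for a Kummer cover. -/
structure KD (V : Scheme.{0}) (l : ℕ) where
  I : Type
  pre : Preorder I
  U : I → V.Opens
  aff : ∀ i, IsAffineOpen (U i)
  le_iff : ∀ i j, i ≤ j ↔ U i ≤ U j
  basis : TopologicalSpace.Opens.IsBasis (Set.range U)
  u : ∀ i, Γ(V, U i)
  hu : ∀ i, IsUnit (u i)
  g : ∀ i j, i ≤ j → Γ(V, U i)
  g' : ∀ i j, i ≤ j → Γ(V, U i)
  hg : ∀ i j h, g i j h * g' i j h = 1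
  rel : ∀ i j h, u i = g i j h ^ l * rr ((le_iff i j).1 h) (u j)
  g_comp : ∀ i j k (h : i ≤ j) (h' : j ≤ k),
    g i k (h.trans h') = g i j h * rr ((le_iff i j).1 h) (g j k h')

namespace KD
variable {V : Scheme.{0}} {l : ℕ} (K : KD V l)

instance : Preorder K.I := K.pre

theorem gu (i j h) : IsUnit (K.g i j h) := IsUnit.of_mul_eq_one _ (K.hg i j h)

theorem g_self (i) : K.g i i le_rfl = 1 := by
  have := K.g_comp i i i le_rfl le_rfl
  rw [rr_self] at this
  exact (K.gu i i le_rfl).mul_left_cancel (by rw [← this, mul_one])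

theorem g'_self (i) : K.g' i i le_rfl = 1 := by
  have := K.hg i i le_rfl
  rwa [K.g_self, one_mul] at this

theorem g'_comp (i j k) (h : i ≤ j) (h' : j ≤ k) :
    K.g' i k (h.trans h') = K.g' i j h * rr ((K.le_iff i j).1 h) (K.g' j k h') := by
  apply (K.gu i k (h.trans h')).mul_left_cancel
  rw [K.hg, K.g_comp i j k h h']
  have h1 := K.hg i j h
  have h2 := congrArg (rr ((K.le_iff i j).1 h)) (K.hg j k h')
  rw [map_mul, map_one] at h2
  linear_combination -h1 - (K.g i j h * K.g' i j h) * h2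

theorem rel' (i j h) : rr ((K.le_iff i j).1 h) (K.u j) = K.g' i j h ^ l * K.u i := by
  rw [K.rel i j h, ← mul_assoc, ← mul_pow, mul_comm (K.g' i j h), K.hg, one_pow, one_mul]

abbrev A (i : K.I) : Type := kum l (K.u i)

def tr (i j : K.I) (h : i ≤ j) : K.A j →+* K.A i :=
  AdjoinRoot.lift ((AdjoinRoot.of _).comp (rr ((K.le_iff i j).1 h)))
    (AdjoinRoot.of _ (K.g' i j h) * AdjoinRoot.root _) (by
      simp only [Polynomial.eval₂_sub, Polynomial.eval₂_X_pow, Polynomial.eval₂_C,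
        RingHom.comp_apply]
      rw [K.rel' i j h, mul_pow, kum_root, map_mul, map_pow, sub_self])

@[simp] theorem tr_of (i j h) (a) : K.tr i j h (AdjoinRoot.of _ a) =
    AdjoinRoot.of _ (rr ((K.le_iff i j).1 h) a) := by
  simp [tr]

@[simp] theorem tr_root (i j h) : K.tr i j h (AdjoinRoot.root _) =
    AdjoinRoot.of _ (K.g' i j h) * AdjoinRoot.root _ := by
  simp [tr]

theorem kum_ext {R S : Type} [CommRing R] [CommRing S] {l : ℕ} {u : R} (f g : kum l u →+* S)
    (h1 : ∀ a, f (AdjoinRoot.of _ a) = g (AdjoinRoot.of _ a))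
    (h2 : f (AdjoinRoot.root _) = g (AdjoinRoot.root _)) : f = g := by
  refine AdjoinRoot.ringHom_ext (RingHom.ext h1) h2

theorem tr_self (i) : K.tr i i le_rfl = RingHom.id _ := by
  apply kum_ext
  · intro a; simp [rr_self]
  · simp [K.g'_self]

theorem tr_comp (i j k) (h : i ≤ j) (h' : j ≤ k) :
    (K.tr i j h).comp (K.tr j k h') = K.tr i k (h.trans h') := by
  apply kum_ext
  · intro a; simp [rr_rr]
  · simp [K.g'_comp i j k h h']; ring

theorem pushout (i j) (h : i ≤ j) : IsPushout
    (CommRingCat.ofHom (rr ((K.le_iff i j).1 h)))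
    (CommRingCat.ofHom (AdjoinRoot.of (Polynomial.X ^ l - Polynomial.C (K.u j))))
    (CommRingCat.ofHom (AdjoinRoot.of (Polynomial.X ^ l - Polynomial.C (K.u i))))
    (CommRingCat.ofHom (K.tr i j h)) := by
  refine ⟨⟨by ext a; simp⟩, ⟨Limits.PushoutCocone.IsColimit.mk _ ?_ ?_ ?_ ?_⟩⟩
  · intro s
    refine CommRingCat.ofHom (AdjoinRoot.lift s.inl.hom
      (s.inl.hom (K.g i j h) * s.inr.hom (AdjoinRoot.root _)) ?_)
    have hc := ConcreteCategory.congr_hom s.condition (K.u j)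
    simp only [CommRingCat.hom_comp, CommRingCat.hom_ofHom, RingHom.comp_apply,
      ConcreteCategory.comp_apply] at hc
    simp only [Polynomial.eval₂_sub, Polynomial.eval₂_X_pow, Polynomial.eval₂_C]
    rw [mul_pow, ← map_pow s.inr.hom, kum_root]
    conv_lhs => arg 2; rw [K.rel i j h, map_mul, map_pow]
    erw [hc]
    exact sub_self _
  · intro s
    ext a; simp
  · intro s
    have hc : ∀ a, s.inl.hom (rr ((K.le_iff i j).1 h) a) = s.inr.hom (AdjoinRoot.of _ a) :=
      fun a => ConcreteCategory.congr_hom s.condition a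
    apply CommRingCat.hom_ext
    apply kum_ext
    · intro a
      simp [hc]
    · have := congrArg s.inl.hom (K.hg i j h)
      rw [map_mul, map_one] at this
      simp
      linear_combination (s.inr.hom (AdjoinRoot.root _)) * this
  · intro s m h1 h2
    apply CommRingCat.hom_ext
    apply kum_ext
    · intro a
      simp [← h1]
    · have := congrArg (AdjoinRoot.of (Polynomial.X ^ l - Polynomial.C (K.u i))) (K.hg i j h)
      rw [map_mul, map_one] at this
      simp [← h1, ← h2]
      rw [← map_mul, ← map_mul, ← mul_assoc, this, one_mul]

end KD


namespace KD
variable {V : Scheme.{0}} {l : ℕ} (K : KD V l)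

theorem exists_mem (x : V) : ∃ i, x ∈ K.U i := by
  obtain ⟨_, ⟨i, rfl⟩, hx, _⟩ :=
    TopologicalSpace.Opens.isBasis_iff_nbhd.mp K.basis (TopologicalSpace.Opens.mem_top x)
  exact ⟨i, hx⟩

def cov : V.OpenCover where
  I₀ := K.I
  X i := Spec Γ(V, K.U i)
  f i := (K.aff i).fromSpec
  mem₀ := by
    rw [Scheme.presieve₀_mem_precoverage_iff]
    refine ⟨fun x ↦ ?_, fun i => (K.aff i).isOpenImmersion_fromSpec⟩
    obtain ⟨i, hi⟩ := K.exists_mem x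
    refine ⟨i, ?_⟩
    have := (K.aff i).range_fromSpec
    exact this.symm ▸ hi

instance : Preorder K.cov.I₀ := K.pre

def stp (i j : K.I) (h : i ≤ j) : Spec Γ(V, K.U i) ⟶ Spec Γ(V, K.U j) :=
  Spec.map (CommRingCat.ofHom (rr ((K.le_iff i j).1 h)))

theorem stp_f (i j h) : K.stp i j h ≫ (K.aff j).fromSpec = (K.aff i).fromSpec :=
  (K.aff j).map_fromSpec (K.aff i) _

theorem stp_id (i) : K.stp i i le_rfl = 𝟙 _ := by
  rw [← cancel_mono (K.aff i).fromSpec, Category.id_comp, K.stp_f]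

theorem stp_comp (i j k) (h : i ≤ j) (h' : j ≤ k) :
    K.stp i k (h.trans h') = K.stp i j h ≫ K.stp j k h' := by
  rw [← cancel_mono (K.aff k).fromSpec, Category.assoc, K.stp_f, K.stp_f, K.stp_f]

theorem stp_open (i j) (h : i ≤ j) : IsOpenImmersion (K.stp i j h) := by
  have h1 : IsOpenImmersion (K.stp i j h ≫ (K.aff j).fromSpec) := by
    rw [K.stp_f]; infer_instance
  exact IsOpenImmersion.of_comp _ (K.aff j).fromSpec

theorem stp_dir {i j : K.I}
    (x : (Limits.pullback (K.aff i).fromSpec (K.aff j).fromSpec).carrier) :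
    ∃ (k : K.I) (hki : k ≤ i) (hkj : k ≤ j) (y : (Spec Γ(V, K.U k)).carrier),
      Limits.pullback.lift (K.stp k i hki) (K.stp k j hkj)
        (by rw [K.stp_f, K.stp_f]) y = x := by
  have hr : ∀ i, (K.aff i).fromSpec.opensRange = K.U i := fun i => (K.aff i).opensRange_fromSpec
  have : (Limits.pullback.fst (K.aff i).fromSpec (K.aff j).fromSpec ≫ (K.aff i).fromSpec) x ∈
    (Limits.pullback.fst (K.aff i).fromSpec (K.aff j).fromSpec ≫ (K.aff i).fromSpec).opensRange :=
    ⟨x, rfl⟩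
  obtain ⟨_, ⟨k, rfl⟩, hy, h⟩ := TopologicalSpace.Opens.isBasis_iff_nbhd.mp K.basis this
  obtain ⟨y, hy⟩ : _ ∈ (K.aff k).fromSpec.opensRange := (hr k).symm ▸ hy
  refine ⟨k, (K.le_iff k i).2 <| le_trans h ?_, (K.le_iff k j).2 <| le_trans h ?_, y, ?_⟩
  · rw [Scheme.Hom.opensRange_comp]
    refine le_trans ?_ (hr i).le
    exact Set.image_subset_range _ _
  · simp_rw [Limits.pullback.condition, Scheme.Hom.opensRange_comp]
    refine le_trans ?_ (hr j).le
    exact Set.image_subset_range _ _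
  · apply (Limits.pullback.fst (K.aff i).fromSpec (K.aff j).fromSpec ≫
      (K.aff i).fromSpec).isOpenEmbedding.injective
    rw [← Scheme.Hom.comp_apply, Limits.pullback.lift_fst_assoc, ← hy, K.stp_f]

instance locDir : K.cov.LocallyDirected where
  trans {i j} hij := K.stp i j (leOfHom hij)
  trans_id i := K.stp_id i
  trans_comp {i j k} hij hjk := K.stp_comp i j k (leOfHom hij) (leOfHom hjk)
  w {i j} hij := K.stp_f i j _
  directed {i j} x := by
    obtain ⟨k, h1, h2, y, hy⟩ := K.stp_dir x
    exact ⟨k, homOfLE h1, homOfLE h2, y, hy⟩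
  property_trans {i j} hij := K.stp_open i j (leOfHom hij)

def fnc : K.I ⥤ Scheme.{0} where
  obj i := Spec (CommRingCat.of (K.A i))
  map {i j} h := Spec.map (CommRingCat.ofHom (K.tr i j (leOfHom h)))
  map_id i := by
    rw [K.tr_self]; exact Spec.map_id _
  map_comp {i j k} h h' := by
    rw [← Spec.map_comp, ← CommRingCat.ofHom_comp, K.tr_comp]

def nat (i : K.I) : Spec (CommRingCat.of (K.A i)) ⟶ Spec Γ(V, K.U i) :=
  Spec.map (CommRingCat.ofHom (AdjoinRoot.of _))

theorem isPb (i j : K.I) (h : i ≤ j) :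
    IsPullback (K.nat i) (Spec.map (CommRingCat.ofHom (K.tr i j h))) (K.stp i j h) (K.nat j) :=
  isPullback_SpecMap_of_isPushout _ _ _ _ (K.pushout i j h)

def rgd : Scheme.Cover.RelativeGluingData K.cov where
  functor := K.fnc
  natTrans :=
    { app i := K.nat i
      naturality i j h := (K.isPb i j (leOfHom h)).w.symm }
  equifibered i j h := (K.isPb i j (leOfHom h)).flip

end KD


theorem isUnit_natCast_of_complex {V : Scheme.{0}} (p : V ⟶ Spec (CommRingCat.of ℂ)) {l : ℕ}
    (hl : 1 ≤ l) (U : V.Opens) : IsUnit (l : Γ(V, U)) := by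
  let f : ℂ →+* Γ(V, U) := (rr (X := V) (le_top : U ≤ ⊤)).comp
    (((Scheme.ΓSpecIso (CommRingCat.of ℂ)).inv ≫ p.appTop).hom)
  have : IsUnit (l : ℂ) := by
    rw [isUnit_iff_ne_zero]; exact_mod_cast (by omega)
  have := this.map f
  rwa [map_natCast] at this

theorem zlt_finite : IsZariskiLocalAtTarget @IsFinite.{0} :=
  @HasAffineProperty.instIsZariskiLocalAtTarget @IsFinite.{0} _
    IsFinite.instHasAffinePropertyAndIsAffineFiniteCarrierObjOppositeOpensCarrierCarrierCommRingCatPresheafOpOpensTopHomAppTop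

theorem zlt_etale : IsZariskiLocalAtTarget @Etale.{0} :=
  HasRingHomProperty.instIsZariskiLocalAtTarget (P := @Etale.{0}) (Q := RingHom.Etale)

namespace KD
variable {V : Scheme.{0}} {l : ℕ} (K : KD V l)

instance : Small.{0} K.cov.I₀ := inferInstanceAs (Small.{0} K.I)

instance : Quiver.IsThin K.cov.I₀ := inferInstanceAs (Quiver.IsThin K.I)

abbrev W : Scheme.{0} := K.rgd.glued

def q : K.W ⟶ V := K.rgd.toBase

def inc (i : K.I) : Spec (CommRingCat.of (K.A i)) ⟶ K.W :=
  Limits.colimit.ι K.rgd.functor i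

theorem inc_w (i j) (h : i ≤ j) :
    Spec.map (CommRingCat.ofHom (K.tr i j h)) ≫ K.inc j = K.inc i :=
  Limits.colimit.w K.rgd.functor (homOfLE h : (i : K.I) ⟶ j)

theorem isPbq (i : K.I) : IsPullback (K.nat i) (K.inc i) (K.aff i).fromSpec K.q :=
  K.rgd.isPullback_natTrans_ι_toBase i

theorem q_prop (P : MorphismProperty Scheme.{0}) [IsZariskiLocalAtTarget P]
    (h : ∀ i, P (K.nat i)) : P K.q := by
  rw [IsZariskiLocalAtTarget.iff_of_openCover (P := P) K.cov]
  intro i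
  have e := (K.isPbq i).flip
  have h2 : e.isoPullback.hom ≫ Limits.pullback.snd K.q (K.aff i).fromSpec = K.nat i := by simp
  have h3 : P (Limits.pullback.snd K.q (K.aff i).fromSpec) := by
    rw [← P.cancel_left_of_respectsIso e.isoPullback.hom, h2]
    exact h i
  exact h3

theorem q_finite (hl : 1 ≤ l) : IsFinite K.q := by
  have := zlt_finite
  refine KD.q_prop (P := @IsFinite.{0}) K (fun i => ?_)
  rw [nat, IsFinite.SpecMap_iff]
  exact (RingHom.finite_algebraMap (A := Γ(V, K.U i)) (B := K.A i)).2 (kum_finite hl _)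

theorem q_etale (p : V ⟶ Spec (CommRingCat.of ℂ)) (hl : 1 ≤ l) : Etale K.q := by
  have := zlt_etale
  refine KD.q_prop (P := @Etale.{0}) K (fun i => ?_)
  rw [nat, HasRingHomProperty.Spec_iff (P := @Etale)]
  exact (RingHom.etale_algebraMap (R := Γ(V, K.U i)) (S := K.A i)).2
    (kum_etale hl _ (K.hu i) (isUnit_natCast_of_complex p hl _))

theorem W_nonempty (hl : 1 ≤ l) [Nonempty V] : Nonempty K.W := by
  obtain ⟨x⟩ := ‹Nonempty V›
  obtain ⟨i, hi⟩ := K.exists_mem x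
  have : Nonempty (K.U i) := ⟨⟨x, hi⟩⟩
  have : Nontrivial Γ(V, K.U i) := inferInstance
  have := kum_nontriv hl (K.u i)
  have : Nonempty (Spec (CommRingCat.of (K.A i))) :=
    inferInstanceAs (Nonempty (PrimeSpectrum (K.A i)))
  exact this.map (K.inc i)

theorem main (hl : 1 ≤ l) (hconn : ConnectedSpace V)
    (p : V ⟶ Spec (CommRingCat.of ℂ)) (hft : LocallyOfFiniteType p) (hqc : QuasiCompact p)
    (hpi1 : ∀ (W : Scheme.{0}) (q : W ⟶ V), ConnectedSpace W → IsFinite q → Etale q →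
      AlgebraicGeometry.Surjective q → IsIso q) :
    ∃ t : ∀ i, Γ(V, K.U i), (∀ i, t i ^ l = K.u i) ∧
      ∀ i j (h : i ≤ j), t i = K.g i j h * rr ((K.le_iff i j).1 h) (t j) := by
  obtain ⟨σ, hσ⟩ := exists_section V hconn p hft hqc hpi1 K.W K.q (K.q_finite hl)
    (K.q_etale p hl) (K.W_nonempty hl)
  have ex : ∀ i, ∃ τ : CommRingCat.of (K.A i) ⟶ Γ(V, K.U i),
      Spec.map τ ≫ K.nat i = 𝟙 _ ∧ Spec.map τ ≫ K.inc i = (K.aff i).fromSpec ≫ σ := by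
    intro i
    refine ⟨Spec.preimage ((K.isPbq i).lift (𝟙 _) ((K.aff i).fromSpec ≫ σ) (by simp [hσ])), ?_, ?_⟩
    · rw [Spec.map_preimage, IsPullback.lift_fst]
    · rw [Spec.map_preimage, IsPullback.lift_snd]
  choose τ h1 h2 using ex
  have h1' : ∀ i a, (τ i).hom (AdjoinRoot.of _ a) = a := by
    intro i a
    have := h1 i
    rw [nat, ← Spec.map_comp, ← Spec.map_id, Spec.map_inj] at this
    exact ConcreteCategory.congr_hom this a
  have h3 : ∀ i j (h : i ≤ j), Spec.map (τ i) ≫ Spec.map (CommRingCat.ofHom (K.tr i j h)) =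
      K.stp i j h ≫ Spec.map (τ j) := by
    intro i j h
    apply (K.isPbq j).hom_ext
    · rw [Category.assoc, ← (K.isPb i j h).w, reassoc_of% (h1 i), Category.assoc, h1 j,
        Category.comp_id]
    · rw [Category.assoc, K.inc_w, h2, Category.assoc, h2, ← Category.assoc, K.stp_f]
  have h4 : ∀ i j (h : i ≤ j) (a : K.A j), (τ i).hom (K.tr i j h a) =
      rr ((K.le_iff i j).1 h) ((τ j).hom a) := by
    intro i j h a
    have := h3 i j h
    rw [stp, ← Spec.map_comp, ← Spec.map_comp, Spec.map_inj] at this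
    exact ConcreteCategory.congr_hom this a
  refine ⟨fun i => (τ i).hom (AdjoinRoot.root _), fun i => ?_, fun i j h => ?_⟩
  · show (τ i).hom (AdjoinRoot.root _) ^ l = _
    rw [← map_pow, kum_root, h1']
  · show (τ i).hom (AdjoinRoot.root _) = K.g i j h * rr ((K.le_iff i j).1 h) ((τ j).hom (AdjoinRoot.root _))
    rw [← h4 i j h, tr_root, map_mul, h1', ← mul_assoc, K.hg, one_mul]

end KD


theorem IsGen.smul_unit {X : Scheme.{0}} {L : X.Modules} {U : X.Opens} {s : Γ(L, U)}
    (hs : IsGen L s) (a : Γ(X, U)) (ha : IsUnit a) : IsGen L (a • s) := by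
  intro W h
  have hb := hs W h
  have hu : IsUnit (rr h a) := ha.map _
  have e : (fun b : Γ(X, W) => b • _root_.rs L h (a • s)) =
      (fun b : Γ(X, W) => b • _root_.rs L h s) ∘ (fun b => b * rr h a) := by
    funext b
    simp only [Function.comp]
    rw [rs_smul, smul_smul]
  rw [e]
  exact hb.comp ((IsUnit.isUnit_iff_mulRight_bijective).1 hu)

structure GI {X : Scheme.{0}} (L : X.Modules) where
  U : X.Opens
  aff : IsAffineOpen U
  s : Γ(L, U)
  gen : IsGen L s

instance {X : Scheme.{0}} (L : X.Modules) : Preorder (GI L) :=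
  Preorder.lift (fun i => i.U)

theorem GI.basis {X : Scheme.{0}} (L : X.Modules) (hL : IsInvertibleSheaf X L) :
    TopologicalSpace.Opens.IsBasis (Set.range (fun i : GI L => i.U)) := by
  rw [TopologicalSpace.Opens.isBasis_iff_nbhd]
  intro U x hx
  obtain ⟨W, s, hxW, hs⟩ := exists_gen L hL x
  obtain ⟨A, hA, hxA, hAU⟩ := TopologicalSpace.Opens.isBasis_iff_nbhd.1 X.isBasis_affineOpens
    (show x ∈ U ⊓ W from ⟨hx, hxW⟩)
  exact ⟨A, ⟨⟨A, hA, rs L (hAU.trans inf_le_right) s, hs.rs _⟩, rfl⟩, hxA, hAU.trans inf_le_left⟩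

theorem GI.exists_g {X : Scheme.{0}} {L : X.Modules} (i j : GI L) (h : i.U ≤ j.U) :
    ∃ g g' : Γ(X, i.U), i.s = g • rs L h j.s ∧ g * g' = 1 := by
  obtain ⟨g, hg⟩ := (j.gen i.U h).2 i.s
  obtain ⟨g', hg'⟩ := (i.gen i.U le_rfl).2 (rs L h j.s)
  dsimp only at hg hg'
  rw [rs_self] at hg'
  refine ⟨g, g', hg.symm, ?_⟩
  apply (i.gen i.U le_rfl).1
  dsimp only
  rw [rs_self, mul_smul, hg', hg, one_smul]

def GI.g {X : Scheme.{0}} {L : X.Modules} (i j : GI L) (h : i.U ≤ j.U) : Γ(X, i.U) :=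
  (GI.exists_g i j h).choose
def GI.g' {X : Scheme.{0}} {L : X.Modules} (i j : GI L) (h : i.U ≤ j.U) : Γ(X, i.U) :=
  (GI.exists_g i j h).choose_spec.choose
theorem GI.g_s {X : Scheme.{0}} {L : X.Modules} (i j : GI L) (h : i.U ≤ j.U) :
    i.s = i.g j h • rs L h j.s := (GI.exists_g i j h).choose_spec.choose_spec.1
theorem GI.g_g' {X : Scheme.{0}} {L : X.Modules} (i j : GI L) (h : i.U ≤ j.U) :
    i.g j h * i.g' j h = 1 := (GI.exists_g i j h).choose_spec.choose_spec.2

def mkKD {X : Scheme.{0}} (L : X.Modules) (hL : IsInvertibleSheaf X L) (l : ℕ)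
    (φ : sheafPow X L l ≅ OX X) : KD X l where
  I := GI L
  pre := inferInstance
  U i := i.U
  aff i := i.aff
  le_iff _ _ := Iff.rfl
  basis := GI.basis L hL
  u i := ev φ i.U (pw L i.s l)
  hu i := pw_unit L i.s i.gen l φ
  g i j h := i.g j h
  g' i j h := i.g' j h
  hg i j h := i.g_g' j h
  rel i j h := by
    have h : i.U ≤ j.U := h
    refine (congrArg (fun t => ev φ i.U (pw L t l)) (i.g_s j h)).trans ?_
    rw [pw_smul, map_smul, ← pw_rs, ← ev_rs, smul_eq_mul]
  g_comp i j k h h' := by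
    have h : i.U ≤ j.U := h
    have h' : j.U ≤ k.U := h'
    apply (k.gen i.U (h.trans h')).1
    dsimp only
    rw [← i.g_s k, mul_smul, ← rs_rs L h' h, ← rs_smul, ← j.g_s k, ← i.g_s j]

theorem main_thm (V : Scheme.{0}) (hconn : ConnectedSpace V)
    (p : V ⟶ Spec (CommRingCat.of ℂ)) (hft : LocallyOfFiniteType p) (hqc : QuasiCompact p)
    (hpi1 : ∀ (W : Scheme.{0}) (q : W ⟶ V), ConnectedSpace W → IsFinite q → Etale q →
      AlgebraicGeometry.Surjective q → IsIso q)
    (L : V.Modules) (hL : IsInvertibleSheaf V L) (l : ℕ) (hl : 1 ≤ l)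
    (φ : sheafPow V L l ≅ OX V) : Nonempty (L ≅ OX V) := by
  obtain ⟨t, ht, htg⟩ : ∃ t : ∀ i : GI L, Γ(V, i.U),
      (∀ i : GI L, t i ^ l = ev φ i.U (pw L i.s l)) ∧
      ∀ (i j : GI L) (h : i.U ≤ j.U), t i = i.g j h * rr h (t j) :=
    (mkKD L hL l φ).main hl hconn p hft hqc hpi1
  have ht' : ∀ i : GI L, ∃ r : Γ(V, i.U), t i * r = 1 := by
    intro i
    have h1 : IsUnit (t i ^ l) := by rw [ht i]; exact pw_unit L i.s i.gen l φ
    exact ((isUnit_pow_iff (by omega)).1 h1).exists_right_inv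
  choose r hr using ht'
  have compat : ∀ (i j : GI L) (h : i.U ≤ j.U), r i • i.s = rs L h (r j • j.s) := by
    intro i j h
    have e1 : t i = i.g j h * rr h (t j) := htg i j h
    have e2 := congrArg (rr h) (hr j)
    rw [map_mul, map_one] at e2
    have e3 := hr i
    rw [e1] at e3
    rw [i.g_s j h, rs_smul, smul_smul]
    congr 1
    linear_combination (- (r i * i.g j h)) * e2 + (rr h (r j)) * e3
  have hb : ∀ {U : V.Opens} {x : V}, x ∈ U →
      ∃ U' ∈ Set.range (fun i : GI L => i.U), x ∈ U' ∧ U' ≤ U :=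
    TopologicalSpace.Opens.isBasis_iff_nbhd.1 (GI.basis L hL)
  have hcov : ∀ x : V, ∃ i : GI L, x ∈ i.U := by
    intro x
    obtain ⟨_, ⟨i, rfl⟩, hx, _⟩ := hb (TopologicalSpace.Opens.mem_top x)
    exact ⟨i, hx⟩
  obtain ⟨e, he⟩ := rs_glue L (fun i : GI L => i.U) hcov (fun i => r i • i.s) (by
    intro i j x hi hj
    obtain ⟨_, ⟨k, rfl⟩, hx, hk⟩ := hb (show x ∈ i.U ⊓ j.U from ⟨hi, hj⟩)
    refine ⟨k.U, hk.trans inf_le_left, hk.trans inf_le_right, hx, ?_⟩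
    exact (compat k i _).symm.trans (compat k j _))
  refine iso_of_gen L e (isGen_of_local L e fun x _ => ?_)
  obtain ⟨i, hi⟩ := hcov x
  refine ⟨i.U, le_top, hi, ?_⟩
  rw [he i]
  exact i.gen.smul_unit _ (IsUnit.of_mul_eq_one_right _ (hr i))

end

/-- Let `V` be a connected scheme of finite type over `ℂ` whose étale
fundamental group is trivial, i.e. every finite étale surjective morphism `W → V` with `W`
connected is an isomorphism. Then the Picard group of `V` is torsion-free: every invertible
`O_V`-module `L` such that `L^{⊗ℓ}` is trivial for some `ℓ ≥ 1` is itself trivial. -/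
theorem pic_torsionfree_of_simply_connected (V : Scheme.{0}) (hconn : ConnectedSpace V)
    (p : V ⟶ Spec (CommRingCat.of ℂ)) (hft : LocallyOfFiniteType p) (hqc : QuasiCompact p)
    (hpi1 : ∀ (W : Scheme.{0}) (q : W ⟶ V), ConnectedSpace W → IsFinite q → IsEtale q →
      AlgebraicGeometry.Surjective q → IsIso q)
    (L : V.Modules) (hL : IsInvertibleSheaf V L) (ℓ : ℕ) (hℓ : 1 ≤ ℓ)
    (htriv : Nonempty (sheafPow V L ℓ ≅ SheafOfModules.unit V.ringCatSheaf)) :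
    Nonempty (L ≅ SheafOfModules.unit V.ringCatSheaf) := by
  exact main_thm V hconn p hft hqc hpi1 L hL ℓ hℓ htriv.some

end
end

section
/- Let f ∈ S be a nonzero weighted-homogeneous quasismooth polynomial of degree d with n ≥ 1, and suppose the weighted projective space ℙ(a_0,…,a_{n+1}) is well-formed. Then the linear automorphism group Lin(X) = G_f/Δ of the hypersurface X = {f=0} is finite if and only if one of the following holds: (1) d > 2·max{a_0,…,a_{n+1}}; or (2) d = 2·max{a_0,…,a_{n+1}} and exactly one weight attains the maximum. -/
open MvPolynomial

noncomputable section

/-- The predicate that an algebra automorphism of `ℂ[x_0,…,x_{n+1}]` is graded with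
respect to the weights `a`, i.e. preserves all weighted-homogeneous pieces. -/
def IsGradedAut {n : ℕ} (a : Fin (n + 2) → ℕ)
    (φ : MvPolynomial (Fin (n + 2)) ℂ ≃ₐ[ℂ] MvPolynomial (Fin (n + 2)) ℂ) : Prop :=
  ∀ (d : ℕ) (f : MvPolynomial (Fin (n + 2)) ℂ),
    f.IsWeightedHomogeneous a d ↔ (φ f).IsWeightedHomogeneous a d

lemma IsGradedAut.one {n : ℕ} (a : Fin (n + 2) → ℕ) : IsGradedAut a 1 := by
  intro d f
  rfl

lemma IsGradedAut.mul {n : ℕ} {a : Fin (n + 2) → ℕ}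
    {φ ψ : MvPolynomial (Fin (n + 2)) ℂ ≃ₐ[ℂ] MvPolynomial (Fin (n + 2)) ℂ}
    (hφ : IsGradedAut a φ) (hψ : IsGradedAut a ψ) : IsGradedAut a (φ * ψ) := by
  intro d f
  rw [AlgEquiv.mul_apply]
  exact (hψ d f).trans (hφ d (ψ f))

lemma IsGradedAut.inv {n : ℕ} {a : Fin (n + 2) → ℕ}
    {φ : MvPolynomial (Fin (n + 2)) ℂ ≃ₐ[ℂ] MvPolynomial (Fin (n + 2)) ℂ}
    (hφ : IsGradedAut a φ) : IsGradedAut a φ⁻¹ := by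
  intro d f
  have h := hφ d (φ⁻¹ f)
  rw [show φ (φ⁻¹ f) = f from φ.apply_symm_apply f] at h
  exact h.symm

/-- The group of graded automorphisms `Aut(S)`. -/
def gradedAut {n : ℕ} (a : Fin (n + 2) → ℕ) :
    Subgroup (MvPolynomial (Fin (n + 2)) ℂ ≃ₐ[ℂ] MvPolynomial (Fin (n + 2)) ℂ) where
  carrier := {φ | IsGradedAut a φ}
  one_mem' := IsGradedAut.one a
  mul_mem' hφ hψ := hφ.mul hψ
  inv_mem' hφ := hφ.inv

/-- The group `G_f` of graded automorphisms mapping `f` to a nonzero scalar multiple of itself. -/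
def linGroup {n : ℕ} (a : Fin (n + 2) → ℕ) (f : MvPolynomial (Fin (n + 2)) ℂ) :
    Subgroup (MvPolynomial (Fin (n + 2)) ℂ ≃ₐ[ℂ] MvPolynomial (Fin (n + 2)) ℂ) where
  carrier := {φ | IsGradedAut a φ ∧ ∃ c : ℂˣ, φ f = (c : ℂ) • f}
  one_mem' := ⟨IsGradedAut.one a, 1, by simp⟩
  mul_mem' := by
    rintro φ ψ ⟨hφ, c₁, hc₁⟩ ⟨hψ, c₂, hc₂⟩
    refine ⟨hφ.mul hψ, c₁ * c₂, ?_⟩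
    rw [AlgEquiv.mul_apply, hc₂, map_smul, hc₁, smul_smul, Units.val_mul, mul_comm]
  inv_mem' := by
    rintro φ ⟨hφ, c, hc⟩
    refine ⟨hφ.inv, c⁻¹, ?_⟩
    rw [show φ⁻¹ f = φ.symm f from rfl, AlgEquiv.symm_apply_eq, map_smul, hc, smul_smul]
    simp

/-- The subgroup `Δ` of diagonal scalar automorphisms `x_i ↦ t^{a_i} x_i`. -/
def diagSubgroup {n : ℕ} (a : Fin (n + 2) → ℕ) :
    Subgroup (MvPolynomial (Fin (n + 2)) ℂ ≃ₐ[ℂ] MvPolynomial (Fin (n + 2)) ℂ) where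
  carrier := {φ | ∃ t : ℂˣ, ∀ i, φ (X i) = ((t : ℂ) ^ (a i)) • X i}
  one_mem' := ⟨1, fun i => by simp⟩
  mul_mem' := by
    rintro φ ψ ⟨t, ht⟩ ⟨s, hs⟩
    refine ⟨t * s, fun i => ?_⟩
    rw [AlgEquiv.mul_apply, hs i, map_smul, ht i, smul_smul, Units.val_mul, mul_pow, mul_comm]
  inv_mem' := by
    rintro φ ⟨t, ht⟩
    refine ⟨t⁻¹, fun i => ?_⟩
    have key : φ (((t⁻¹ : ℂˣ) : ℂ) ^ (a i) • X i) = X i := by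
      rw [map_smul, ht i, smul_smul, ← mul_pow]
      norm_num
    rw [show φ⁻¹ (X i) = φ.symm (X i) from rfl, AlgEquiv.symm_apply_eq]
    exact key.symm

/-- Quasismoothness of the hypersurface `{f = 0}`: the punctured affine cone is smooth, i.e.
at every nonzero point of the affine cone some partial derivative of `f` is nonzero. -/
def Quasismooth {n : ℕ} (f : MvPolynomial (Fin (n + 2)) ℂ) : Prop :=
  ∀ x : Fin (n + 2) → ℂ, x ≠ 0 → eval x f = 0 → ∃ i, eval x (pderiv i f) ≠ 0

/-- Well-formedness of the weighted projective space `ℙ(a_0,…,a_{n+1})`: omitting any one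
weight, the remaining weights have gcd `1`. -/
def WellFormed {n : ℕ} (a : Fin (n + 2) → ℕ) : Prop :=
  ∀ i : Fin (n + 2), (Finset.univ.erase i).gcd a = 1

structure KData (R : Type) [CommRing R] (n : ℕ) (p : Fin n → R) where
  ι : Type
  fin : Finite ι
  d : (ι → R) →ₗ[R] (ι → R)
  w : (Fin n → R) → (ι → R) →ₗ[R] (ι → R)
  G : ℕ → (ι → R) → Prop
  u : ι → R
  k0 : ι
  dd : ∀ z, d (d z) = 0
  hom : ∀ c z, d (w c z) + w c (d z) = (∑ i, c i * p i) • z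
  wG : ∀ c i z, G i z → G (i + 1) (w c z)
  Gtop : ∀ i z, n < i → G i z → z = 0
  uG : G 0 u
  du : d u = 0
  uk : u k0 = 1
  ex : ∀ c i, ∃ k, w c u k = c i
  dI : ∀ z k, d z k ∈ Ideal.span (Set.range p)
  wz : ∀ i, G i 0
  wl : ∀ i (r : R) x y, G i x → G i y → G i (r • x - y)

def Ksplit (R : Type) [CommRing R] (ι : Type) : (ι ⊕ ι → R) ≃ₗ[R] (ι → R) × (ι → R) :=
  LinearEquiv.sumArrowLequivProdArrow ι ι R R

theorem exists_KData (R : Type) [CommRing R] (n : ℕ) (p : Fin n → R) : Nonempty (KData R n p) := by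
  induction n with
  | zero =>
    refine ⟨{ ι := Unit, fin := inferInstance, d := 0, w := fun _ => 0,
              G := fun i z => i ≠ 0 → z = 0, u := fun _ => 1, k0 := (), dd := ?_, hom := ?_,
              wG := ?_, Gtop := ?_, uG := ?_, du := ?_, uk := rfl, ex := ?_, dI := ?_, wz := ?_, wl := ?_ }⟩
    · simp
    · simp
    · simp
    · intro i z hi h; exact h (by omega)
    · intro h; exact absurd rfl h
    · simp
    · intro c i; exact i.elim0
    · simp
    · simp
    · intro i r x y hx hy h
      rw [hx h, hy h]; simp
  | succ n ih =>
    obtain ⟨K⟩ := ih (fun i => p i.succ)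
    have := K.fin
    let e := Ksplit R K.ι
    let D : (K.ι → R) × (K.ι → R) →ₗ[R] (K.ι → R) × (K.ι → R) :=
      LinearMap.prod (K.d ∘ₗ LinearMap.fst R _ _ + p 0 • LinearMap.snd R _ _)
        (- (K.d ∘ₗ LinearMap.snd R _ _))
    let W : (Fin (n+1) → R) → (K.ι → R) × (K.ι → R) →ₗ[R] (K.ι → R) × (K.ι → R) := fun c =>
      LinearMap.prod (K.w (fun i => c i.succ) ∘ₗ LinearMap.fst R _ _)
        (c 0 • LinearMap.fst R _ _ - (K.w (fun i => c i.succ) ∘ₗ LinearMap.snd R _ _))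
    have hD : ∀ x y, D (x, y) = (K.d x + p 0 • y, - K.d y) := fun x y => rfl
    have hW : ∀ c x y, W c (x, y) = (K.w (fun i => c i.succ) x,
      c 0 • x - K.w (fun i => c i.succ) y) := fun c x y => rfl
    refine ⟨{ ι := K.ι ⊕ K.ι, fin := inferInstance,
              d := e.symm.toLinearMap ∘ₗ D ∘ₗ e.toLinearMap,
              w := fun c => e.symm.toLinearMap ∘ₗ W c ∘ₗ e.toLinearMap,
              G := fun i z => K.G i (e z).1 ∧ ((e z).2 = 0 ∨ ∃ j, i = j + 1 ∧ K.G j (e z).2),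
              u := e.symm (K.u, 0), k0 := Sum.inl K.k0,
              dd := ?_, hom := ?_,
              wG := ?_, Gtop := ?_, uG := ?_, du := ?_, uk := ?_, ex := ?_, dI := ?_, wz := ?_, wl := ?_ }⟩
    · intro z
      obtain ⟨⟨x, y⟩, rfl⟩ := e.symm.surjective z
      simp [hD, K.dd]
    · intro c z
      obtain ⟨⟨x, y⟩, rfl⟩ := e.symm.surjective z
      have h1 := K.hom (fun i => c i.succ) x
      have h2 := K.hom (fun i => c i.succ) y
      simp only [LinearMap.comp_apply, LinearEquiv.coe_coe, LinearEquiv.apply_symm_apply, hD, hW,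
        Fin.sum_univ_succ]
      rw [← map_add, ← map_smul]
      congr 1
      rw [Prod.mk_add_mk, Prod.smul_mk, add_smul, add_smul, ← h1, ← h2]
      simp only [map_add, map_sub, map_smul, map_neg, smul_sub, mul_smul, smul_add]
      congr 1
      · rw [smul_comm]; abel
      · rw [smul_comm]; abel
    · rintro c i z ⟨h1, h2⟩
      obtain ⟨⟨x, y⟩, rfl⟩ := e.symm.surjective z
      simp only [LinearMap.comp_apply, LinearEquiv.coe_coe, LinearEquiv.apply_symm_apply, hW] at *
      refine ⟨K.wG _ _ _ h1, Or.inr ⟨i, rfl, ?_⟩⟩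
      rcases h2 with h2 | ⟨j, rfl, h⟩
      · subst h2
        exact K.wl _ _ _ _ h1 (by rw [map_zero]; exact K.wz _)
      · exact K.wl _ _ _ _ h1 (K.wG _ _ _ h)
    · rintro i z hi ⟨h1, h2⟩
      obtain ⟨⟨x, y⟩, rfl⟩ := e.symm.surjective z
      simp only [LinearEquiv.apply_symm_apply] at *
      have hx := K.Gtop i x (by omega) h1
      have hy : y = 0 := by
        rcases h2 with h | ⟨j, rfl, h⟩
        · exact h
        · exact K.Gtop j y (by omega) h
      subst hx hy
      exact map_zero _
    · simp [K.uG]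
    · simp [hD, K.du]
    · exact K.uk
    · intro c i
      simp only [LinearMap.comp_apply, LinearEquiv.coe_coe, LinearEquiv.apply_symm_apply, hW, map_zero, sub_zero]
      refine Fin.cases ?_ (fun i => ?_) i
      · refine ⟨Sum.inr K.k0, ?_⟩
        change c 0 * K.u K.k0 = _
        rw [K.uk, mul_one]
      · obtain ⟨k, hk⟩ := K.ex (fun i => c i.succ) i
        exact ⟨Sum.inl k, hk⟩
    · intro z k
      obtain ⟨⟨x, y⟩, rfl⟩ := e.symm.surjective z
      have hle : Ideal.span (Set.range fun i : Fin n => p i.succ) ≤ Ideal.span (Set.range p) := by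
        apply Ideal.span_mono
        rintro _ ⟨i, rfl⟩
        exact ⟨_, rfl⟩
      simp only [LinearMap.comp_apply, LinearEquiv.coe_coe, LinearEquiv.apply_symm_apply, hD]
      rcases k with k | k
      · change K.d x k + p 0 * y k ∈ _
        exact add_mem (hle (K.dI _ _)) (Ideal.mul_mem_right _ _ (Ideal.subset_span ⟨0, rfl⟩))
      · change - K.d y k ∈ _
        exact neg_mem (hle (K.dI _ _))
    · intro i
      simp [K.wz]
    · rintro i r x y ⟨h1, h2⟩ ⟨h3, h4⟩
      refine ⟨by simpa using K.wl _ _ _ _ h1 h3, ?_⟩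
      rcases i with _ | i
      · left
        have h2' : (e x).2 = 0 := by
          rcases h2 with h | ⟨j, h, _⟩
          · exact h
          · omega
        have h4' : (e y).2 = 0 := by
          rcases h4 with h | ⟨j, h, _⟩
          · exact h
          · omega
        simp [h2', h4']
      · right
        refine ⟨i, rfl, ?_⟩
        have h2' : K.G i (e x).2 := by
          rcases h2 with h | ⟨j, h, h'⟩
          · rw [h]; exact K.wz _
          · obtain rfl : i = j := by omega
            exact h'
        have h4' : K.G i (e y).2 := by
          rcases h4 with h | ⟨j, h, h'⟩
          · rw [h]; exact K.wz _
          · obtain rfl : i = j := by omega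
            exact h'
        simpa using K.wl _ r _ _ h2' h4'

/-- relations lemma -/
theorem koszul_rel (R : Type) [CommRing R] (n : ℕ) (p q : Fin n → R)
    (hq : ∀ i, q i ∈ Ideal.span (Set.range p))
    (hreg : ∀ (k : Fin n) (r : R), q k * r ∈ Ideal.span (q '' {j | j < k}) →
      r ∈ Ideal.span (q '' {j | j < k}))
    (δ : Fin n → R) (hδ : ∑ i, δ i * p i = 0) (i : Fin n) : δ i ∈ Ideal.span (Set.range p) := by
  obtain ⟨K⟩ := exists_KData R n p
  have := K.fin
  have hc : ∀ k, ∃ c : Fin n → R, ∑ i, c i * p i = q k := fun k => by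
    have := hq k
    rwa [Ideal.mem_span_range_iff_exists_fun] at this
  choose c hc using hc
  let Q : ℕ → Ideal R := fun k => Ideal.span (q '' {j | (j : ℕ) < k})
  have hQ : ∀ (k : ℕ), ∀ (h : k < n) x, x ∈ Q (k+1) → ∃ y, x - q ⟨k, h⟩ * y ∈ Q k := by
    intro k h x hx
    have hset : {j : Fin n | (j : ℕ) < k + 1} = insert ⟨k, h⟩ {j : Fin n | (j : ℕ) < k} := by
      ext j
      simp only [Set.mem_ofPred_eq, Set.mem_insert_iff, Fin.ext_iff]
      omega
    simp only [Q, hset, Set.image_insert_eq] at hx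
    rw [Ideal.mem_span_insert] at hx
    obtain ⟨a, z, hz, rfl⟩ := hx
    exact ⟨a, by simpa [mul_comm] using hz⟩
  have hQm : ∀ (k : ℕ), Q k ≤ Q (k+1) := by
    intro k
    apply Ideal.span_mono
    apply Set.image_mono
    intro j hj
    simp only [Set.mem_ofPred_eq] at *
    omega
  have hQq : ∀ (k : ℕ) (h : k < n), q ⟨k, h⟩ ∈ Q (k+1) := by
    intro k h
    exact Ideal.subset_span ⟨⟨k, h⟩, by simp, rfl⟩
  have main : ∀ j k i, k + j = n → i + j = n + 1 → ∀ z, K.G i z → (∀ κ, K.d z κ ∈ Q k) →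
      ∃ u, ∀ κ, z κ - K.d u κ ∈ Q k := by
    intro j
    induction j with
    | zero =>
      intro k i hk hi z hz _
      refine ⟨0, fun κ => ?_⟩
      rw [K.Gtop i z (by omega) hz]
      simp
    | succ j ih =>
      intro k i hk hi z hz hd
      have hkn : k < n := by omega
      have hom := K.hom (c ⟨k, hkn⟩) z
      rw [hc] at hom
      have hw : ∀ κ, K.w (c ⟨k, hkn⟩) (K.d z) κ ∈ Q k := fun κ => Ideal.map_pi _ _ hd _ _
      have hdw : ∀ κ, K.d (K.w (c ⟨k, hkn⟩) z) κ ∈ Q (k+1) := by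
        intro κ
        have h := congrFun hom κ
        simp only [Pi.add_apply, Pi.smul_apply, smul_eq_mul] at h
        rw [← eq_sub_iff_add_eq] at h
        rw [h]
        exact sub_mem (Ideal.mul_mem_right _ _ (hQq _ _)) (hQm _ (hw κ))
      obtain ⟨v, hv⟩ := ih (k+1) (i+1) (by omega) (by omega) _ (K.wG _ _ _ hz) hdw
      choose u hu using fun κ => hQ k hkn _ (hv κ)
      refine ⟨u, fun κ => ?_⟩
      have hr := Ideal.map_pi (Q k) (fun κ => K.w (c ⟨k, hkn⟩) z κ - K.d v κ - q ⟨k, hkn⟩ * u κ) hu K.d κ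
      have e1 : (fun κ => K.w (c ⟨k, hkn⟩) z κ - K.d v κ - q ⟨k, hkn⟩ * u κ) =
        K.w (c ⟨k, hkn⟩) z - K.d v - q ⟨k, hkn⟩ • u := rfl
      rw [e1, map_sub, map_sub, K.dd, sub_zero, map_smul] at hr
      apply hreg ⟨k, hkn⟩
      have h := congrFun hom κ
      simp only [Pi.add_apply, Pi.smul_apply, smul_eq_mul, Pi.sub_apply] at h hr
      have : q ⟨k, hkn⟩ * (z κ - K.d u κ) = (K.d (K.w (c ⟨k, hkn⟩) z) κ - q ⟨k, hkn⟩ * K.d u κ)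
        + K.w (c ⟨k, hkn⟩) (K.d z) κ := by rw [mul_sub, ← h]; ring
      rw [this]
      exact add_mem hr (hw κ)
  obtain ⟨k, hk⟩ := K.ex δ i
  have h0 : K.d (K.w δ K.u) = 0 := by
    have := K.hom δ K.u
    rw [hδ, K.du, map_zero, add_zero, zero_smul] at this
    exact this
  obtain ⟨u, hu⟩ := main n 0 1 (by omega) (by omega) _ (K.wG δ _ _ K.uG)
    (by intro κ; rw [h0]; exact zero_mem _)
  have := hu k
  simp only [Q, Nat.not_lt_zero, Set.ofPred_false, Set.image_empty, Ideal.span_empty, Ideal.mem_bot] at this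
  rw [← hk, sub_eq_zero.1 this]
  exact K.dI _ _

theorem pd_rel {n : ℕ} (a : Fin (n + 2) → ℕ) (d : ℕ) (hd : 0 < d)
    (f : MvPolynomial (Fin (n + 2)) ℂ) (hfh : f.IsWeightedHomogeneous a d) (hq : Quasismooth f)
    (δ : Fin (n + 2) → MvPolynomial (Fin (n + 2)) ℂ) (h : ∑ i, δ i * pderiv i f = 0)
    (i : Fin (n + 2)) : δ i ∈ Ideal.span (Set.range fun i => pderiv i f) := by
  set I := Ideal.span (Set.range fun i => pderiv i f) with hI
  have hX : ∀ i, (X i : MvPolynomial (Fin (n + 2)) ℂ) ∈ I.radical := by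
    intro i
    rw [← vanishingIdeal_zeroLocus_eq_radical (K := ℂ), mem_vanishingIdeal_iff]
    intro x hx
    rw [mem_zeroLocus_iff] at hx
    have hx' : ∀ j, eval x (pderiv j f) = 0 := by
      intro j
      have := hx (pderiv j f) (Ideal.subset_span ⟨j, rfl⟩)
      rwa [aeval_eq_eval] at this
    have hx0 : x = 0 := by
      by_contra hne
      have he := congrArg (eval x) hfh.sum_weight_X_mul_pderiv
      simp only [map_sum, map_nsmul, map_mul, hx', mul_zero, smul_zero, Finset.sum_const_zero] at he
      have hf : eval x f = 0 := by
        simpa [hd.ne'] using he.symm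
      obtain ⟨j, hj⟩ := hq x hne hf
      exact hj (hx' j)
    simp [hx0]
  choose M hM using hX
  let T := ∑ i, M i
  have hT : ∀ i, (X i : MvPolynomial (Fin (n + 2)) ℂ) ^ T ∈ I := fun i =>
    Ideal.pow_mem_of_pow_mem I (hM i) (Finset.single_le_sum (f := M) (fun _ _ => Nat.zero_le _) (Finset.mem_univ i))
  refine koszul_rel _ (n + 2) (fun i => pderiv i f) (fun i => X i ^ T) hT ?_ δ h i
  intro k r hr
  have himg : ((fun i : Fin (n+2) => (X i : MvPolynomial (Fin (n + 2)) ℂ) ^ T) '' {j | j < k}) =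
      (fun s => monomial s (1 : ℂ)) '' ((fun i => Finsupp.single i T) '' {j | j < k}) := by
    rw [Set.image_image]
    simp only [X_pow_eq_monomial]
  rw [himg, mem_ideal_span_monomial_image] at hr ⊢
  intro e he
  obtain ⟨s, ⟨j, hj, rfl⟩, hs⟩ := hr (Finsupp.single k T + e) (by
    rw [mem_support_iff] at he ⊢
    rw [X_pow_eq_monomial, coeff_monomial_mul, one_mul]
    exact he)
  refine ⟨_, ⟨j, hj, rfl⟩, ?_⟩
  have hjk : k ≠ j := (ne_of_lt hj).symm
  have := hs j
  simp only [Finsupp.add_apply, Finsupp.single_eq_same] at this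
  rw [Finsupp.single_eq_of_ne' hjk, zero_add] at this
  simpa using this

theorem ideal_weight {n : ℕ} (a : Fin (n + 2) → ℕ) (L : ℕ)
    (p : Fin (n + 2) → MvPolynomial (Fin (n + 2)) ℂ)
    (hp : ∀ i, ∀ e ∈ (p i).support, L ≤ Finsupp.weight a e)
    (x : MvPolynomial (Fin (n + 2)) ℂ) (hx : x ∈ Ideal.span (Set.range p)) :
    ∀ e ∈ x.support, L ≤ Finsupp.weight a e := by
  have hle : Ideal.span (Set.range p) ≤ Ideal.span ((fun s => monomial s (1 : ℂ)) ''
      {e | L ≤ Finsupp.weight a e}) := by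
    rw [Ideal.span_le]
    rintro _ ⟨i, rfl⟩
    rw [SetLike.mem_coe, mem_ideal_span_monomial_image]
    intro e he
    exact ⟨e, hp i e he, le_rfl⟩
  have := hle hx
  rw [mem_ideal_span_monomial_image] at this
  intro e he
  obtain ⟨s, hs, hse⟩ := this e he
  obtain ⟨t, rfl⟩ := exists_add_of_le hse
  rw [map_add]
  exact le_trans hs (Nat.le_add_right _ _)

theorem vf_zero {n : ℕ} (a : Fin (n + 2) → ℕ) (ha : ∀ i, 0 < a i) (d : ℕ)
    (f : MvPolynomial (Fin (n + 2)) ℂ) (hfh : f.IsWeightedHomogeneous a d) (hq : Quasismooth f)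
    (hc : 2 * Finset.univ.sup a < d ∨
        (d = 2 * Finset.univ.sup a ∧ ∃! i, a i = Finset.univ.sup a))
    (δ : Fin (n + 2) → MvPolynomial (Fin (n + 2)) ℂ)
    (hδ : ∀ i, (δ i).IsWeightedHomogeneous a (a i))
    (h : ∑ i, δ i * pderiv i f = 0) : ∀ i, δ i = 0 := by
  have hle : ∀ i, a i ≤ Finset.univ.sup a := fun i => Finset.le_sup (Finset.mem_univ i)
  set S := Finset.univ.sup a with hS
  have hS0 : 0 < S := lt_of_lt_of_le (ha 0) (hle 0)
  have hd : 0 < d := by omega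
  have hw : ∀ i, ∀ e ∈ (pderiv i f).support, d - S ≤ Finsupp.weight a e := by
    intro i e he
    have h1 : (pderiv i f).IsWeightedHomogeneous a (d - a i) :=
      hfh.pderiv (by have := hle i; omega)
    have := h1 (mem_support_iff.1 he)
    have := hle i
    omega
  have small : ∀ i, a i < d - S → δ i = 0 := by
    intro i hi
    ext e
    rw [coeff_zero]
    by_contra hne
    have h1 := hδ i hne
    have h2 := ideal_weight a (d - S) _ hw _ (pd_rel a d hd f hfh hq δ h i) e (mem_support_iff.2 hne)
    omega
  rcases hc with hc | ⟨hc, m, hm, huniq⟩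
  · intro i
    exact small i (by have := hle i; omega)
  · have hsm : ∀ i, i ≠ m → δ i = 0 := by
      intro i hi
      apply small
      have : a i ≠ S := fun h => hi (huniq i h)
      have := hle i
      omega
    have hpm : pderiv m f ≠ 0 := by
      intro h0
      have := pd_rel a d hd f hfh hq (Pi.single m 1) (by
        rw [Finset.sum_eq_single m]
        · simp [h0]
        · intro j _ hj; simp [Pi.single_eq_of_ne hj]
        · simp) m
      have h2 := ideal_weight a (d - S) _ hw _ this 0 (by simp)
      simp at h2
      omega
    rw [Finset.sum_eq_single m (fun j _ hj => by rw [hsm j hj, zero_mul]) (by simp)] at h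
    intro i
    by_cases hi : i = m
    · subst hi
      exact (mul_eq_zero.1 h).resolve_right hpm
    · exact hsm i hi

theorem taylor_sq {σ : Type} [Fintype σ] {B : Type} [CommRing B]
    (g δ : σ → MvPolynomial σ B) (hδ : ∀ i j, δ i * δ j = 0) (p : MvPolynomial σ B) :
    aeval (fun i => g i + δ i) p = aeval g p + ∑ i, aeval g (pderiv i p) * δ i := by
  classical
  induction p using MvPolynomial.induction_on with
  | C b => simp [algebraMap_eq]
  | add p q hp hq =>
    simp only [map_add, hp, hq, add_mul, Finset.sum_add_distrib]
    ring
  | mul_X p j hp =>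
    have key : (∑ i, aeval g (pderiv i p) * δ i) * δ j = 0 := by
      rw [Finset.sum_mul]
      exact Finset.sum_eq_zero fun i _ => by rw [mul_assoc, hδ, mul_zero]
    have h2 : ∑ i, aeval g (pderiv i (p * X j)) * δ i =
        (∑ i, aeval g (pderiv i p) * δ i) * g j + aeval g p * δ j := by
      simp only [pderiv_mul, pderiv_X, map_add, map_mul, aeval_X, add_mul, Finset.sum_add_distrib,
        Finset.sum_mul]
      congr 1
      · exact Finset.sum_congr rfl fun i _ => by ring
      · rw [Finset.sum_eq_single j]
        · simp
        · intro i _ hi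
          simp [Pi.single_eq_of_ne' hi]
        · simp
    rw [map_mul, hp, map_mul, aeval_X, aeval_X, h2]
    linear_combination key

theorem aeval_homog {σ : Type} [Fintype σ] {B : Type} [CommRing B] (a : σ → ℕ)
    (g : σ → MvPolynomial σ B) (hg : ∀ i, (g i).IsWeightedHomogeneous a (a i))
    (m : ℕ) (p : MvPolynomial σ B) (hp : p.IsWeightedHomogeneous a m) :
    (aeval g p).IsWeightedHomogeneous a m := by
  rw [aeval_def, eval₂_eq']
  refine IsWeightedHomogeneous.sum _ _ _ fun e he => ?_
  rw [algebraMap_eq]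
  apply IsWeightedHomogeneous.C_mul
  have : m = ∑ i, e i • a i := by
    rw [← hp (mem_support_iff.1 he), Finsupp.weight_apply, Finsupp.sum_fintype]
    simp
  rw [this]
  exact IsWeightedHomogeneous.prod _ _ _ fun i _ => (hg i).pow _

def lfun {σ : Type} {B : Type} [CommRing B] [Algebra ℂ B] (l : B →ₗ[ℂ] ℂ) (p : MvPolynomial σ B) :
    MvPolynomial σ ℂ := ∑ e ∈ p.support, monomial e (l (coeff e p))

theorem coeff_lfun {σ : Type} {B : Type} [CommRing B] [Algebra ℂ B] (l : B →ₗ[ℂ] ℂ)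
    (p : MvPolynomial σ B) (e : σ →₀ ℕ) : coeff e (lfun l p) = l (coeff e p) := by
  classical
  rw [lfun, coeff_sum]
  simp only [coeff_monomial]
  rw [Finset.sum_ite_eq']
  split_ifs with h
  · rfl
  · rw [notMem_support_iff.1 h, map_zero]

theorem lfun_mul {σ : Type} {B : Type} [CommRing B] [Algebra ℂ B] (l : B →ₗ[ℂ] ℂ)
    (p : MvPolynomial σ B) (q : MvPolynomial σ ℂ) :
    lfun l (p * map (algebraMap ℂ B) q) = lfun l p * q := by
  classical
  ext e
  rw [coeff_lfun, coeff_mul, coeff_mul, map_sum]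
  refine Finset.sum_congr rfl fun x _ => ?_
  rw [coeff_map, coeff_lfun, mul_comm, ← Algebra.smul_def, map_smul, smul_eq_mul, mul_comm]

theorem lfun_sum {σ ι : Type} {B : Type} [CommRing B] [Algebra ℂ B] (l : B →ₗ[ℂ] ℂ)
    (s : Finset ι) (p : ι → MvPolynomial σ B) :
    lfun l (∑ i ∈ s, p i) = ∑ i ∈ s, lfun l (p i) := by
  ext e
  simp only [coeff_lfun, coeff_sum, map_sum]

def FinCond {n : ℕ} (a : Fin (n + 2) → ℕ) (d : ℕ) : Prop := 2 * Finset.univ.sup a < d ∨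
        (d = 2 * Finset.univ.sup a ∧ ∃! i, a i = Finset.univ.sup a)

theorem vf_zero_B {n : ℕ} (a : Fin (n + 2) → ℕ) (ha : ∀ i, 0 < a i) (d : ℕ)
    (f : MvPolynomial (Fin (n + 2)) ℂ) (hfh : f.IsWeightedHomogeneous a d) (hq : Quasismooth f)
    (hc : FinCond a d) {B : Type} [CommRing B] [Algebra ℂ B]
    (δ : Fin (n + 2) → MvPolynomial (Fin (n + 2)) B)
    (hδ : ∀ i, (δ i).IsWeightedHomogeneous a (a i))
    (h : ∑ i, δ i * pderiv i (map (algebraMap ℂ B) f) = 0) : ∀ i, δ i = 0 := by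
  intro i
  ext e
  rw [coeff_zero, ← Module.forall_dual_apply_eq_zero_iff ℂ]
  intro l
  rw [← coeff_lfun]
  rw [vf_zero a ha d f hfh hq hc (fun i => lfun l (δ i)) ?_ ?_ i, coeff_zero]
  · intro i e he
    rw [coeff_lfun] at he
    exact hδ i (fun h => he (by rw [h, map_zero]))
  · simp only [← lfun_mul, ← pderiv_map]
    rw [← lfun_sum, h]
    simp [lfun]

abbrev UU {n : ℕ} (a : Fin (n + 2) → ℕ) : Type :=
  Σ i : Fin (n + 2), {e : Fin (n + 2) →₀ ℕ // Finsupp.weight a e = a i}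

theorem fin_wt {n : ℕ} (a : Fin (n + 2) → ℕ) (ha : ∀ i, 0 < a i) (m : ℕ) :
    Finite {e : Fin (n + 2) →₀ ℕ // Finsupp.weight a e = m} :=
  Set.Finite.subset (Finsupp.finite_of_nat_weight_le a (fun i => (ha i).ne') m)
    (fun e (he : Finsupp.weight a e = m) => he.le)

section
variable {n : ℕ} (a : Fin (n + 2) → ℕ) (ha : ∀ i, 0 < a i)
variable {B : Type} [CommRing B]

def genp (u : UU a → B) (i : Fin (n + 2)) : MvPolynomial (Fin (n + 2)) B :=
  ∑ᶠ e : {e : Fin (n + 2) →₀ ℕ // Finsupp.weight a e = a i}, monomial e.1 (u ⟨i, e⟩)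

include ha in
theorem coeff_genp (u : UU a → B) (i : Fin (n + 2)) (e : Fin (n + 2) →₀ ℕ) :
    coeff e (genp a u i) = if h : Finsupp.weight a e = a i then u ⟨i, e, h⟩ else 0 := by
  classical
  have := fin_wt a ha (a i)
  have := Fintype.ofFinite {e : Fin (n + 2) →₀ ℕ // Finsupp.weight a e = a i}
  rw [genp, finsum_eq_sum_of_fintype, coeff_sum]
  simp only [coeff_monomial]
  split_ifs with h
  · rw [Finset.sum_eq_single ⟨e, h⟩]
    · simp
    · intro b _ hb
      rw [if_neg]
      intro h'
      exact hb (Subtype.ext h')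
    · simp
  · apply Finset.sum_eq_zero
    intro b _
    rw [if_neg]
    rintro rfl
    exact h b.2

include ha in
theorem genp_homog (u : UU a → B) (i : Fin (n + 2)) :
    (genp a u i).IsWeightedHomogeneous a (a i) := by
  intro e he
  rw [coeff_genp a ha] at he
  by_contra h
  rw [dif_neg h] at he
  exact he rfl

include ha in
theorem genp_of (g : Fin (n + 2) → MvPolynomial (Fin (n + 2)) B)
    (hg : ∀ i, (g i).IsWeightedHomogeneous a (a i)) :
    genp a (fun x => coeff x.2.1 (g x.1)) = g := by
  funext i
  ext e
  rw [coeff_genp a ha]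
  split_ifs with h
  · rfl
  · exact ((hg i).coeff_eq_zero e h).symm

include ha in
theorem genp_inj (u v : UU a → B) (h : genp a u = genp a v) : u = v := by
  funext ⟨i, e, he⟩
  have := congrArg (coeff e) (congrFun h i)
  simpa [coeff_genp a ha, he] using this

include ha in
theorem genp_map {B' : Type} [CommRing B'] (θ : B →+* B') (u : UU a → B) (i : Fin (n + 2)) :
    map θ (genp a u i) = genp a (fun x => θ (u x)) i := by
  ext e
  rw [coeff_map, coeff_genp a ha, coeff_genp a ha]
  split_ifs <;> simp

structure PCond (f : MvPolynomial (Fin (n + 2)) ℂ) [Algebra ℂ B] (u v : UU a → B) : Prop where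
  h1 : aeval (genp a u) (map (algebraMap ℂ B) f) = map (algebraMap ℂ B) f
  h2 : ∀ i, aeval (genp a v) (genp a u i) = X i
  h3 : ∀ i, aeval (genp a u) (genp a v i) = X i

include ha in
theorem pcond_unique (d : ℕ)
    (f : MvPolynomial (Fin (n + 2)) ℂ) (hfh : f.IsWeightedHomogeneous a d) (hq : Quasismooth f)
    (hc : FinCond a d) [Algebra ℂ B] (J : Ideal B) (hJ : J ^ 2 = ⊥) (u v u' v' : UU a → B)
    (h : PCond a f u v) (h' : PCond a f u' v') (hu : ∀ x, u' x - u x ∈ J) : u = u' ∧ v = v' := by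
  set g := genp a u
  set k := genp a v
  set δ : Fin (n + 2) → MvPolynomial (Fin (n + 2)) B := fun i => genp a u' i - g i with hδ
  have hδJ : ∀ i e, coeff e (δ i) ∈ J := by
    intro i e
    simp only [hδ, g, coeff_sub, coeff_genp a ha]
    split_ifs
    · exact hu _
    · simp
  have hδδ : ∀ i j, δ i * δ j = 0 := by
    intro i j
    classical
    ext e
    rw [coeff_mul, coeff_zero]
    refine Finset.sum_eq_zero fun x _ => ?_
    have := Ideal.mul_mem_mul (hδJ i x.1) (hδJ j x.2)
    rwa [← pow_two, hJ, Ideal.mem_bot] at this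
  have hkg : ∀ p, aeval k (aeval g p) = p := by
    intro p
    have : (aeval k).comp (aeval g) = AlgHom.id B (MvPolynomial (Fin (n+2)) B) := by
      ext i : 1
      simpa using h.h2 i
    exact DFunLike.congr_fun this p
  have hgk : ∀ p, aeval g (aeval k p) = p := by
    intro p
    have : (aeval g).comp (aeval k) = AlgHom.id B (MvPolynomial (Fin (n+2)) B) := by
      ext i : 1
      simpa using h.h3 i
    exact DFunLike.congr_fun this p
  have e1 : genp a u' = fun i => g i + δ i := by
    funext i; simp [hδ]
  have ht := taylor_sq g δ hδδ (map (algebraMap ℂ B) f)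
  rw [← e1, h'.h1, h.h1, left_eq_add] at ht
  have ht2 := congrArg (aeval k) ht
  simp only [map_sum, map_mul, hkg, map_zero] at ht2
  have hz := vf_zero_B a ha d f hfh hq hc (fun i => aeval k (δ i)) (fun i =>
    aeval_homog a k (genp_homog a ha v) _ _ ((genp_homog a ha u' i).sub (genp_homog a ha u i)))
    (by simpa [mul_comm] using ht2)
  have hδ0 : ∀ i, δ i = 0 := by
    intro i
    rw [← hgk (δ i), hz i, map_zero]
  have hg : genp a u = genp a u' := by
    rw [e1]; funext i; simp [hδ0, g]
  refine ⟨genp_inj a ha _ _ hg, genp_inj a ha _ _ ?_⟩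
  funext i
  have := h'.h3 i
  rw [← hg] at this
  rw [← hkg (genp a v' i), this, aeval_X]

def bigSet (f : MvPolynomial (Fin (n + 2)) ℂ) : Set (MvPolynomial (UU a ⊕ UU a) ℂ) :=
  let uC : UU a → MvPolynomial (UU a ⊕ UU a) ℂ := fun x => X (Sum.inl x)
  let vC : UU a → MvPolynomial (UU a ⊕ UU a) ℂ := fun x => X (Sum.inr x)
  (Set.range fun e => coeff e (aeval (genp a uC) (map (algebraMap ℂ (MvPolynomial (UU a ⊕ UU a) ℂ)) f) -
    map (algebraMap ℂ (MvPolynomial (UU a ⊕ UU a) ℂ)) f))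
  ∪ (Set.range fun x : Fin (n + 2) × (Fin (n + 2) →₀ ℕ) =>
      coeff x.2 (aeval (genp a vC) (genp a uC x.1) - X x.1))
  ∪ (Set.range fun x : Fin (n + 2) × (Fin (n + 2) →₀ ℕ) =>
      coeff x.2 (aeval (genp a uC) (genp a vC x.1) - X x.1))

theorem map_aeval_poly {B' : Type} [CommRing B'] (θ : B →+* B')
    (g : Fin (n + 2) → MvPolynomial (Fin (n + 2)) B) (p : MvPolynomial (Fin (n + 2)) B) :
    map θ (aeval g p) = aeval (fun i => map θ (g i)) (map θ p) := by
  induction p using MvPolynomial.induction_on with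
  | C b => simp [algebraMap_eq]
  | add p q hp hq => simp only [map_add, hp, hq]
  | mul_X p j hp => simp only [map_mul, hp, aeval_X, map_X]

include ha in
theorem bigSet_iff (f : MvPolynomial (Fin (n + 2)) ℂ) [Algebra ℂ B]
    (θ : MvPolynomial (UU a ⊕ UU a) ℂ →ₐ[ℂ] B) :
    (∀ x ∈ bigSet a f, θ x = 0) ↔
      PCond a f (fun x => θ (X (Sum.inl x))) (fun x => θ (X (Sum.inr x))) := by
  have hz : ∀ p : MvPolynomial (Fin (n + 2)) (MvPolynomial (UU a ⊕ UU a) ℂ),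
      (∀ e, θ (coeff e p) = 0) ↔ map (θ : MvPolynomial (UU a ⊕ UU a) ℂ →+* B) p = 0 := by
    intro p
    rw [MvPolynomial.ext_iff]
    simp [coeff_map]
  have hθ : (θ : MvPolynomial (UU a ⊕ UU a) ℂ →+* B).comp (algebraMap ℂ _) = algebraMap ℂ B :=
    θ.comp_algebraMap
  simp only [bigSet, Set.mem_union, or_imp, forall_and, Set.forall_mem_range, Prod.forall, hz]
  simp only [map_sub, map_aeval_poly, map_map, hθ, genp_map a ha, map_X, sub_eq_zero,
    RingHom.coe_coe]
  constructor
  · rintro ⟨⟨h1, h2⟩, h3⟩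
    exact ⟨h1, h2, h3⟩
  · rintro ⟨h1, h2, h3⟩
    exact ⟨⟨h1, h2⟩, h3⟩

include ha in
theorem finite_alg (d : ℕ)
    (f : MvPolynomial (Fin (n + 2)) ℂ) (hfh : f.IsWeightedHomogeneous a d) (hq : Quasismooth f)
    (hc : FinCond a d) :
    Finite ((MvPolynomial (UU a ⊕ UU a) ℂ ⧸ Ideal.span (bigSet a f)) →ₐ[ℂ] ℂ) := by
  have := fun i => fin_wt a ha (a i)
  have hU : Finite (UU a) := inferInstance
  have hun : Algebra.FormallyUnramified ℂ (MvPolynomial (UU a ⊕ UU a) ℂ ⧸ Ideal.span (bigSet a f)) := by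
    rw [Algebra.FormallyUnramified.iff_comp_injective]
    intro B _ _ J hJ α β hαβ
    have key : ∀ γ : (MvPolynomial (UU a ⊕ UU a) ℂ ⧸ Ideal.span (bigSet a f)) →ₐ[ℂ] B,
        PCond a f (fun x => (γ.comp (Ideal.Quotient.mkₐ ℂ _)) (X (Sum.inl x)))
          (fun x => (γ.comp (Ideal.Quotient.mkₐ ℂ _)) (X (Sum.inr x))) := by
      intro γ
      rw [← bigSet_iff a ha]
      intro x hx
      rw [AlgHom.comp_apply, Ideal.Quotient.mkₐ_eq_mk, Ideal.Quotient.eq_zero_iff_mem.2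
        (Ideal.subset_span hx), map_zero]
    obtain ⟨h1, h2⟩ := pcond_unique a ha d f hfh hq hc J hJ _ _ _ _ (key α) (key β) (by
      intro x
      rw [← Ideal.Quotient.eq_zero_iff_mem, map_sub, sub_eq_zero]
      exact (DFunLike.congr_fun hαβ (Ideal.Quotient.mkₐ ℂ _ (X (Sum.inl x)))).symm)
    apply Ideal.Quotient.algHom_ext
    apply MvPolynomial.algHom_ext
    rintro (x | x)
    · exact congrFun h1 x
    · exact congrFun h2 x
  have : Module.Finite ℂ (MvPolynomial (UU a ⊕ UU a) ℂ ⧸ Ideal.span (bigSet a f)) :=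
    Algebra.FormallyUnramified.finite_of_free ℂ _
  infer_instance

include ha in
theorem finite_H (d : ℕ)
    (f : MvPolynomial (Fin (n + 2)) ℂ) (hfh : f.IsWeightedHomogeneous a d) (hq : Quasismooth f)
    (hc : FinCond a d) :
    Finite {φ : MvPolynomial (Fin (n + 2)) ℂ ≃ₐ[ℂ] MvPolynomial (Fin (n + 2)) ℂ //
      IsGradedAut a φ ∧ φ f = f} := by
  have hfin := finite_alg a ha d f hfh hq hc
  have hex : ∀ φ : {φ : MvPolynomial (Fin (n + 2)) ℂ ≃ₐ[ℂ] MvPolynomial (Fin (n + 2)) ℂ //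
      IsGradedAut a φ ∧ φ f = f},
      ∃ θ : (MvPolynomial (UU a ⊕ UU a) ℂ ⧸ Ideal.span (bigSet a f)) →ₐ[ℂ] ℂ,
        ∀ x : UU a, θ (Ideal.Quotient.mk _ (X (Sum.inl x))) = coeff x.2.1 (φ.1 (X x.1)) := by
    rintro ⟨φ, hφ, hφf⟩
    have hg : ∀ i, (φ (X i)).IsWeightedHomogeneous a (a i) := fun i =>
      (hφ _ _).1 (isWeightedHomogeneous_X _ _ _)
    have hk : ∀ i, (φ.symm (X i)).IsWeightedHomogeneous a (a i) := fun i =>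
      (hφ _ _).2 (by rw [AlgEquiv.apply_symm_apply]; exact isWeightedHomogeneous_X _ _ _)
    have hga : ∀ p, aeval (fun i => φ (X i)) p = φ p := by
      intro p
      have : aeval (fun i => φ (X i)) = (φ : MvPolynomial (Fin (n + 2)) ℂ →ₐ[ℂ] _) := by
        ext i : 1; simp
      rw [this]; rfl
    have hka : ∀ p, aeval (fun i => φ.symm (X i)) p = φ.symm p := by
      intro p
      have : aeval (fun i => φ.symm (X i)) = (φ.symm : MvPolynomial (Fin (n + 2)) ℂ →ₐ[ℂ] _) := by
        ext i : 1; simp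
      rw [this]; rfl
    let θ0 : MvPolynomial (UU a ⊕ UU a) ℂ →ₐ[ℂ] ℂ := aeval (Sum.elim
      (fun x => coeff x.2.1 (φ (X x.1))) (fun x => coeff x.2.1 (φ.symm (X x.1))))
    have h0 : ∀ x ∈ bigSet a f, θ0 x = 0 := by
      rw [bigSet_iff a ha]
      simp only [θ0, aeval_X, Sum.elim_inl, Sum.elim_inr]
      constructor
      · rw [genp_of a ha _ hg, Algebra.algebraMap_self, map_id, hga, hφf]
      · intro i
        rw [genp_of a ha _ hg, genp_of a ha _ hk, hka, AlgEquiv.symm_apply_apply]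
      · intro i
        rw [genp_of a ha _ hg, genp_of a ha _ hk, hga, AlgEquiv.apply_symm_apply]
    have hle : Ideal.span (bigSet a f) ≤ RingHom.ker θ0 :=
      Ideal.span_le.2 (fun x hx => RingHom.mem_ker.2 (h0 x hx))
    have hle' : ∀ x ∈ Ideal.span (bigSet a f), θ0 x = 0 := fun x hx => RingHom.mem_ker.1 (hle hx)
    refine ⟨Ideal.Quotient.liftₐ _ θ0 hle', ?_⟩
    intro x
    have : θ0 (X (Sum.inl x)) = coeff x.2.1 (φ (X x.1)) := by simp [θ0]
    exact this
  choose F hF using hex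
  apply Finite.of_injective F
  rintro ⟨φ, hφ, hφf⟩ ⟨ψ, hψ, hψf⟩ hFe
  rw [Subtype.mk.injEq]
  have hX : ∀ i, φ (X i) = ψ (X i) := by
    intro i
    ext e
    by_cases he : Finsupp.weight a e = a i
    · have h1 := hF ⟨φ, hφ, hφf⟩ ⟨i, e, he⟩
      have h2 := hF ⟨ψ, hψ, hψf⟩ ⟨i, e, he⟩
      rw [hFe] at h1
      exact h1.symm.trans h2
    · rw [((hφ _ _).1 (isWeightedHomogeneous_X ℂ a i)).coeff_eq_zero e he,
        ((hψ _ _).1 (isWeightedHomogeneous_X ℂ a i)).coeff_eq_zero e he]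
  apply AlgEquiv.coe_toAlgHom_injective
  apply MvPolynomial.algHom_ext
  exact hX
end

abbrev SS (n : ℕ) := MvPolynomial (Fin (n + 2)) ℂ

theorem alg_eq_aeval {n : ℕ} (φ : SS n →ₐ[ℂ] SS n) (p : SS n) :
    φ p = aeval (fun i => φ (X i)) p := by
  have : φ = aeval (fun i => φ (X i)) := by
    apply algHom_ext; intro i; simp
  exact congrArg (fun g : SS n →ₐ[ℂ] SS n => g p) this

theorem graded_of {n : ℕ} (a : Fin (n + 2) → ℕ) (φ : SS n ≃ₐ[ℂ] SS n)
    (h1 : ∀ i, (φ (X i)).IsWeightedHomogeneous a (a i))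
    (h2 : ∀ i, (φ.symm (X i)).IsWeightedHomogeneous a (a i)) : IsGradedAut a φ := by
  intro d f
  constructor
  · intro h
    have := aeval_homog a (fun i => φ (X i)) h1 d f h
    have h0 : φ f = aeval (fun i => φ (X i)) f := alg_eq_aeval (φ : SS n →ₐ[ℂ] SS n) f
    rw [h0]
    exact this
  · intro h
    have := aeval_homog a (fun i => φ.symm (X i)) h2 d _ h
    have h0 : φ.symm (φ f) = aeval (fun i => φ.symm (X i)) (φ f) :=
      alg_eq_aeval (φ.symm : SS n →ₐ[ℂ] SS n) (φ f)
    rw [← h0] at this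
    simpa using this

theorem algEquiv_ext_X {n : ℕ} {φ ψ : SS n ≃ₐ[ℂ] SS n} (h : ∀ i, φ (X i) = ψ (X i)) : φ = ψ := by
  apply AlgEquiv.coe_toAlgHom_injective
  apply algHom_ext
  intro i
  exact h i

def tor {n : ℕ} (s : Fin (n + 2) → ℂˣ) : SS n ≃ₐ[ℂ] SS n :=
  AlgEquiv.ofAlgHom (aeval fun i => (s i : ℂ) • X i) (aeval fun i => ((s i)⁻¹ : ℂˣ) • X i)
    (by apply algHom_ext; intro i; simp [Units.smul_def, smul_smul])
    (by apply algHom_ext; intro i; simp [Units.smul_def, smul_smul])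

theorem tor_X {n : ℕ} (s : Fin (n + 2) → ℂˣ) (i) : tor s (X i) = (s i : ℂ) • X i := by
  simp [tor]

theorem tor_symm_X {n : ℕ} (s : Fin (n + 2) → ℂˣ) (i) :
    (tor s).symm (X i) = (((s i)⁻¹ : ℂˣ) : ℂ) • X i := by
  simp [tor, Units.smul_def]

theorem homog_smul {n : ℕ} {a : Fin (n + 2) → ℕ} {m : ℕ} {p : SS n}
    (h : p.IsWeightedHomogeneous a m) (c : ℂ) : (c • p).IsWeightedHomogeneous a m := by
  rw [smul_eq_C_mul]; exact h.C_mul c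

theorem tor_graded {n : ℕ} (a : Fin (n + 2) → ℕ) (s : Fin (n + 2) → ℂˣ) :
    IsGradedAut a (tor s) := by
  apply graded_of
  · intro i; rw [tor_X]; exact homog_smul (isWeightedHomogeneous_X _ _ _) _
  · intro i; rw [tor_symm_X]; exact homog_smul (isWeightedHomogeneous_X _ _ _) _

theorem diag_homog {n : ℕ} (a : Fin (n + 2) → ℕ) (r : ℂˣ) (φ : SS n ≃ₐ[ℂ] SS n)
    (hφ : ∀ i, φ (X i) = ((r : ℂ) ^ a i) • X i) (m : ℕ) (p : SS n)
    (hp : p.IsWeightedHomogeneous a m) : φ p = (r : ℂ) ^ m • p := by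
  have h0 : φ p = aeval (fun i => φ (X i)) p := alg_eq_aeval (φ : SS n →ₐ[ℂ] SS n) p
  rw [h0, aeval_def, eval₂_eq']
  conv_rhs => rw [← support_sum_monomial_coeff p, Finset.smul_sum]
  refine Finset.sum_congr rfl fun e he => ?_
  have : m = ∑ i, e i * a i := by
    rw [← hp (mem_support_iff.1 he), Finsupp.weight_apply, Finsupp.sum_fintype]
    · simp
    · simp
  rw [monomial_eq, this, Finsupp.prod_fintype _ _ (by simp), smul_eq_C_mul, algebraMap_eq,
    mul_left_comm]
  congr 1
  rw [← Finset.prod_pow_eq_pow_sum, map_prod, ← Finset.prod_mul_distrib]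
  refine Finset.prod_congr rfl fun i _ => ?_
  rw [hφ, smul_eq_C_mul, mul_pow, ← map_pow, ← pow_mul, mul_comm (a i)]

theorem sup_pos {n : ℕ} (a : Fin (n + 2) → ℕ) (ha : ∀ i, 0 < a i) : 0 < Finset.univ.sup a :=
  lt_of_lt_of_le (ha 0) (Finset.le_sup (Finset.mem_univ 0))

theorem finite_dir {n : ℕ} (a : Fin (n + 2) → ℕ) (ha : ∀ i, 0 < a i) (d : ℕ) (f : SS n)
    (hfh : f.IsWeightedHomogeneous a d) (hq : Quasismooth f) (hc : FinCond a d) :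
    Finite (linGroup a f ⧸ (diagSubgroup a).subgroupOf (linGroup a f)) := by
  have := finite_H a ha d f hfh hq hc
  have hd : 0 < d := by
    have := sup_pos a ha
    rcases hc with h | ⟨h, -⟩ <;> omega
  let F : {φ : SS n ≃ₐ[ℂ] SS n // IsGradedAut a φ ∧ φ f = f} →
      linGroup a f ⧸ (diagSubgroup a).subgroupOf (linGroup a f) :=
    fun φ => QuotientGroup.mk ⟨φ.1, φ.2.1, 1, by simp [φ.2.2]⟩
  apply Finite.of_surjective F
  intro q
  obtain ⟨⟨φ, hφ, c, hc⟩, rfl⟩ := QuotientGroup.mk_surjective q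
  obtain ⟨t, ht⟩ := IsAlgClosed.exists_pow_nat_eq ((c⁻¹ : ℂˣ) : ℂ) hd
  have ht0 : t ≠ 0 := by
    rintro rfl
    rw [zero_pow hd.ne'] at ht
    exact (c⁻¹).ne_zero ht.symm
  let u : ℂˣ := Units.mk0 t ht0
  let D : SS n ≃ₐ[ℂ] SS n := tor fun i => u ^ a i
  have hD : ∀ i, D (X i) = ((u : ℂ) ^ a i) • X i := by
    intro i; simp [D, tor_X]
  have hDf : D f = (u : ℂ) ^ d • f := diag_homog a u D hD d f hfh
  refine ⟨⟨φ * D, hφ.mul (tor_graded a _), ?_⟩, ?_⟩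
  · rw [AlgEquiv.mul_apply, hDf, map_smul, hc, smul_smul]
    have : (u : ℂ) ^ d = ((c⁻¹ : ℂˣ) : ℂ) := ht
    rw [this]; simp
  · apply QuotientGroup.eq.2
    rw [Subgroup.mem_subgroupOf]
    change (φ * D)⁻¹ * φ ∈ diagSubgroup a
    have : (φ * D)⁻¹ * φ = D⁻¹ := by group
    rw [this]
    exact (diagSubgroup a).inv_mem ⟨u, hD⟩

/-- data witnessing infinitude -/
def InfData {n : ℕ} (a : Fin (n + 2) → ℕ) (f : SS n) : Prop :=
  ∃ Θ : SS n ≃ₐ[ℂ] SS n, IsGradedAut a Θ ∧ ∃ s : ℂˣ → Fin (n + 2) → ℂˣ, ∃ l p,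
    (∀ t, tor (s t) (Θ f) = Θ f) ∧ (∀ t, s t l = 1) ∧ (∀ t, s t p = t)

theorem InfData.comp {n : ℕ} {a : Fin (n + 2) → ℕ} {f : SS n} (Θ : SS n ≃ₐ[ℂ] SS n)
    (hΘ : IsGradedAut a Θ) (h : InfData a (Θ f)) : InfData a f := by
  obtain ⟨Θ', h1, s, l, p, h2⟩ := h
  exact ⟨Θ' * Θ, h1.mul hΘ, s, l, p, h2⟩

theorem diag_comm {n : ℕ} (a : Fin (n + 2) → ℕ) (φ Θ : SS n ≃ₐ[ℂ] SS n)
    (hφ : φ ∈ diagSubgroup a) (hΘ : IsGradedAut a Θ) : φ * Θ = Θ * φ := by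
  obtain ⟨r, hr⟩ := hφ
  apply algEquiv_ext_X
  intro i
  rw [AlgEquiv.mul_apply, AlgEquiv.mul_apply, hr, map_smul]
  exact diag_homog a r φ hr _ _ ((hΘ _ _).1 (isWeightedHomogeneous_X _ _ _))

theorem conj_infinite {n : ℕ} (a : Fin (n + 2) → ℕ) (ha : ∀ i, 0 < a i) (f : SS n)
    (h : InfData a f) :
    ¬ Finite (linGroup a f ⧸ (diagSubgroup a).subgroupOf (linGroup a f)) := by
  intro hfin
  obtain ⟨Θ, hΘ, s, l, p, h1, h2, h3⟩ := h
  have hmem : ∀ t, Θ⁻¹ * tor (s t) * Θ ∈ linGroup a f := by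
    intro t
    refine ⟨(hΘ.inv.mul (tor_graded a _)).mul hΘ, 1, ?_⟩
    rw [AlgEquiv.mul_apply, AlgEquiv.mul_apply, h1]
    simp
  let F : ℂˣ → linGroup a f ⧸ (diagSubgroup a).subgroupOf (linGroup a f) :=
    fun t => QuotientGroup.mk ⟨_, hmem t⟩
  have : Infinite ℂˣ := Infinite.of_injective
    (fun k : ℕ => Units.mk0 ((k : ℂ) + 1) (Nat.cast_add_one_ne_zero k)) (by
      intro k k' h
      have := congrArg Units.val h
      simpa using this)
  obtain ⟨y, hy⟩ := Finite.exists_infinite_fiber F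
  have hy' : (F ⁻¹' {y}).Infinite := Set.infinite_coe_iff.1 hy
  obtain ⟨t0, ht0⟩ := hy'.nonempty
  apply hy'
  have hroots : {r : ℂˣ | r ^ a l = 1}.Finite := by
    have : NeZero (a l) := ⟨(ha l).ne'⟩
    have : Finite (rootsOfUnity (a l) ℂ) := inferInstance
    exact Set.toFinite (rootsOfUnity (a l) ℂ : Set ℂˣ)
  refine (hroots.image fun r => t0 * r ^ a p).subset ?_
  intro t ht
  have heq : F t0 = F t := by
    rw [Set.mem_preimage, Set.mem_singleton_iff] at ht ht0
    rw [ht, ht0]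
  have hD := QuotientGroup.eq.1 heq
  rw [Subgroup.mem_subgroupOf] at hD
  change (Θ⁻¹ * tor (s t0) * Θ)⁻¹ * (Θ⁻¹ * tor (s t) * Θ) ∈ diagSubgroup a at hD
  have hc := diag_comm a _ Θ hD hΘ
  obtain ⟨r, hr⟩ := hD
  set D := (Θ⁻¹ * tor (s t0) * Θ)⁻¹ * (Θ⁻¹ * tor (s t) * Θ) with hDdef
  have e1 : tor (s t) = tor (s t0) * D := by
    have : tor (s t) = tor (s t0) * (Θ * D) * Θ⁻¹ := by rw [hDdef]; group
    rw [this, ← hc]; group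
  have e2 : ∀ i, (s t i : ℂ) = (s t0 i : ℂ) * (r : ℂ) ^ a i := by
    intro i
    have := congrArg (fun g : SS n ≃ₐ[ℂ] SS n => coeff (Finsupp.single i 1) (g (X i))) e1
    simp only [AlgEquiv.mul_apply, hr, map_smul, tor_X, coeff_smul, coeff_X, smul_eq_mul,
      if_true, mul_one] at this
    rw [this, mul_comm]
  have e3 : ∀ i, s t i = s t0 i * r ^ a i := by
    intro i; apply Units.ext; simpa using e2 i
  refine ⟨r, ?_, ?_⟩
  · have := e3 l
    rw [h2, h2, one_mul] at this
    exact this.symm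
  · have := e3 p
    rw [h3, h3] at this
    exact this.symm

/-- polynomials not involving `x_i` -/
def Fr {n : ℕ} (i : Fin (n + 2)) : Subalgebra ℂ (SS n) := supported ℂ {i}ᶜ

theorem mem_Fr {n : ℕ} {i : Fin (n + 2)} {p : SS n} :
    p ∈ Fr i ↔ ∀ e, coeff e p ≠ 0 → e i = 0 := by
  rw [Fr, mem_supported]
  constructor
  · intro h e he
    by_contra hc
    have : i ∈ p.vars := (mem_vars_iff_mem_support i).2 ⟨e, mem_support_iff.2 he, Finsupp.mem_support_iff.2 hc⟩
    exact h this rfl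
  · intro h j hj hji
    obtain ⟨e, he, hje⟩ := (mem_vars_iff_mem_support j).1 hj
    have : j = i := hji
    subst this
    exact Finsupp.mem_support_iff.1 hje (h e (mem_support_iff.1 he))

theorem X_mem_Fr {n : ℕ} {i j : Fin (n + 2)} (h : j ≠ i) : (X j : SS n) ∈ Fr i := by
  rw [Fr, X_mem_supported]; exact h

theorem C_mem_Fr {n : ℕ} {i : Fin (n + 2)} (c : ℂ) : (C c : SS n) ∈ Fr i :=
  (Fr i).algebraMap_mem c

theorem alg_fix {n : ℕ} (φ : SS n →ₐ[ℂ] SS n) (g : SS n) (h : ∀ j, φ (X j) = X j ∨ g ∈ Fr j) :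
    φ g = g := by
  rw [alg_eq_aeval φ g, aeval_def, eval₂_eq']
  conv_rhs => rw [← support_sum_monomial_coeff g]
  refine Finset.sum_congr rfl fun e he => ?_
  rw [monomial_eq, Finsupp.prod_fintype _ _ (by simp), algebraMap_eq]
  congr 1
  refine Finset.prod_congr rfl fun i _ => ?_
  rcases h i with h | h
  · rw [h]
  · rw [mem_Fr.1 h e (mem_support_iff.1 he)]; simp

theorem alg_pres {n : ℕ} (φ : SS n →ₐ[ℂ] SS n) (m : Fin (n + 2))
    (h : ∀ i, i ≠ m → φ (X i) ∈ Fr m) (g : SS n) (hg : g ∈ Fr m) : φ g ∈ Fr m := by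
  rw [alg_eq_aeval φ g, aeval_def, eval₂_eq']
  refine Subalgebra.sum_mem _ fun e he => ?_
  rw [algebraMap_eq]
  refine Subalgebra.mul_mem _ (C_mem_Fr _) (Subalgebra.prod_mem _ fun i _ => ?_)
  by_cases hi : i = m
  · subst hi
    rw [mem_Fr.1 hg e (mem_support_iff.1 he), pow_zero]
    exact Subalgebra.one_mem _
  · exact Subalgebra.pow_mem _ (h i hi) _

theorem shear {n : ℕ} (a : Fin (n + 2) → ℕ) (i : Fin (n + 2)) (c : ℂˣ) (g : SS n) (hg : g ∈ Fr i)
    (hgh : g.IsWeightedHomogeneous a (a i)) :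
    ∃ Θ : SS n ≃ₐ[ℂ] SS n, IsGradedAut a Θ ∧ Θ (X i) = C (c : ℂ) * X i + g ∧
      ∀ j, j ≠ i → Θ (X j) = X j := by
  classical
  let A : SS n →ₐ[ℂ] SS n := aeval (Function.update X i (C (c : ℂ) * X i + g))
  let B : SS n →ₐ[ℂ] SS n := aeval (Function.update X i (C ((c⁻¹ : ℂˣ) : ℂ) * (X i - g)))
  have hAi : A (X i) = C (c : ℂ) * X i + g := by simp [A]
  have hBi : B (X i) = C ((c⁻¹ : ℂˣ) : ℂ) * (X i - g) := by simp [B]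
  have hAj : ∀ j, j ≠ i → A (X j) = X j := by
    intro j hj; simp [A, hj]
  have hBj : ∀ j, j ≠ i → B (X j) = X j := by
    intro j hj; simp [B, hj]
  have hAg : A g = g := alg_fix A g fun j => by
    by_cases hj : j = i
    · subst hj; exact Or.inr hg
    · exact Or.inl (hAj j hj)
  have hBg : B g = g := alg_fix B g fun j => by
    by_cases hj : j = i
    · subst hj; exact Or.inr hg
    · exact Or.inl (hBj j hj)
  have hAC : ∀ z : ℂ, A (C z) = C z := fun z => A.commutes z
  have hBC : ∀ z : ℂ, B (C z) = C z := fun z => B.commutes z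
  have hcc : (C (c : ℂ) * C ((c⁻¹ : ℂˣ) : ℂ) : SS n) = 1 := by
    rw [← C_mul]; simp
  let Θ : SS n ≃ₐ[ℂ] SS n := AlgEquiv.ofAlgHom A B
    (by
      apply algHom_ext; intro j
      by_cases hj : j = i
      · subst hj
        simp only [AlgHom.comp_apply, hBi, map_mul, map_sub, hAC, hAi, hAg, AlgHom.id_apply]
        linear_combination (X j) * hcc
      · simp only [AlgHom.comp_apply, hBj j hj, hAj j hj, AlgHom.id_apply])
    (by
      apply algHom_ext; intro j
      by_cases hj : j = i
      · subst hj
        simp only [AlgHom.comp_apply, hAi, map_mul, map_add, hBC, hBi, hBg, AlgHom.id_apply]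
        linear_combination (X j - g) * hcc
      · simp only [AlgHom.comp_apply, hBj j hj, hAj j hj, AlgHom.id_apply])
  have hX : ∀ j, (X j : SS n).IsWeightedHomogeneous a (a j) := isWeightedHomogeneous_X _ _
  refine ⟨Θ, ?_, hAi, hAj⟩
  apply graded_of
  · intro j
    change (A (X j)).IsWeightedHomogeneous a (a j)
    by_cases hj : j = i
    · subst hj; rw [hAi]; exact ((hX j).C_mul _).add hgh
    · rw [hAj j hj]; exact hX j
  · intro j
    change (B (X j)).IsWeightedHomogeneous a (a j)
    by_cases hj : j = i
    · subst hj; rw [hBi]; exact ((hX j).sub hgh).C_mul _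
    · rw [hBj j hj]; exact hX j

theorem wt_single {n : ℕ} (a : Fin (n + 2) → ℕ) (ha : ∀ i, 0 < a i) (i : Fin (n + 2))
    (e : Fin (n + 2) →₀ ℕ) (he : Finsupp.weight a e = a i) (hi : e i ≠ 0) :
    e = Finsupp.single i 1 := by
  have h1 := Finsupp.weight_sub_single_add (w := a) (i := i) (f := e) hi
  have h2 : Finsupp.weight a (e - Finsupp.single i 1) = 0 := by omega
  have h3 : e - Finsupp.single i 1 = 0 := by
    by_contra hne
    obtain ⟨j, hj⟩ := Finsupp.ne_iff.1 hne
    have := Finsupp.le_weight_of_ne_zero' a hj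
    have := ha j
    omega
  have h4 : Finsupp.single i 1 ≤ e := Finsupp.single_le_iff.2 (Nat.one_le_iff_ne_zero.2 hi)
  exact le_antisymm (tsub_eq_zero_iff_le.1 h3) h4

theorem straighten {n : ℕ} (a : Fin (n + 2) → ℕ) (ha : ∀ i, 0 < a i) (i : Fin (n + 2)) (p : SS n)
    (hp : p.IsWeightedHomogeneous a (a i)) (hc : coeff (Finsupp.single i 1) p ≠ 0) :
    ∃ Θ : SS n ≃ₐ[ℂ] SS n, IsGradedAut a Θ ∧ Θ p = X i ∧ (∀ j, j ≠ i → Θ (X j) = X j) ∧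
      ∀ m, m ≠ i → p ∈ Fr m → Θ (X i) ∈ Fr m := by
  classical
  let c : ℂˣ := Units.mk0 _ hc
  let R : SS n := p - C (c : ℂ) * X i
  have hX : ∀ j, (X j : SS n).IsWeightedHomogeneous a (a j) := isWeightedHomogeneous_X _ _
  have hRh : R.IsWeightedHomogeneous a (a i) := hp.sub ((hX i).C_mul _)
  have hRi : R ∈ Fr i := by
    rw [mem_Fr]
    intro e he
    by_contra hi
    have := wt_single a ha i e (hRh he) hi
    subst this
    apply he
    simp [R, coeff_C_mul, c]
  have hgi : - (C ((c⁻¹ : ℂˣ) : ℂ) * R) ∈ Fr i :=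
    Subalgebra.neg_mem _ (Subalgebra.mul_mem _ (C_mem_Fr _) hRi)
  have hgh : (- (C ((c⁻¹ : ℂˣ) : ℂ) * R)).IsWeightedHomogeneous a (a i) := by
    rw [← neg_mul, ← C_neg]; exact hRh.C_mul _
  obtain ⟨Θ, h1, h2, h3⟩ := shear a i c⁻¹ _ hgi hgh
  have hcc : (C (c : ℂ) * C ((c⁻¹ : ℂˣ) : ℂ) : SS n) = 1 := by
    rw [← C_mul]; simp
  have hΘR : Θ R = R := alg_fix (Θ : SS n →ₐ[ℂ] SS n) R fun j => by
    by_cases hj : j = i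
    · subst hj; exact Or.inr hRi
    · exact Or.inl (h3 j hj)
  have hΘC : ∀ z : ℂ, Θ (C z) = C z := fun z => Θ.commutes z
  refine ⟨Θ, h1, ?_, h3, ?_⟩
  · have : p = R + C (c : ℂ) * X i := by simp [R]
    rw [this, map_add, hΘR, map_mul, hΘC, h2]
    linear_combination (X i - R) * hcc
  · intro m hm hpm
    rw [h2]
    have hXi : (X i : SS n) ∈ Fr m := X_mem_Fr (Ne.symm hm)
    have hR : R ∈ Fr m := Subalgebra.sub_mem _ hpm (Subalgebra.mul_mem _ (C_mem_Fr _) hXi)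
    exact Subalgebra.add_mem _ (Subalgebra.mul_mem _ (C_mem_Fr _) hXi)
      (Subalgebra.neg_mem _ (Subalgebra.mul_mem _ (C_mem_Fr _) hR))

theorem div_homog {n : ℕ} (a : Fin (n + 2) → ℕ) (i : Fin (n + 2)) (p : SS n) (D : ℕ)
    (hp : p.IsWeightedHomogeneous a (a i + D)) :
    (p.divMonomial (Finsupp.single i 1)).IsWeightedHomogeneous a D := by
  intro e he
  rw [coeff_divMonomial] at he
  have := hp he
  rw [map_add, Finsupp.weight_single] at this
  simpa using this

theorem div_Fr {n : ℕ} (i m : Fin (n + 2)) (p : SS n) (hp : p ∈ Fr m) :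
    p.divMonomial (Finsupp.single i 1) ∈ Fr m := by
  rw [mem_Fr] at *
  intro e he
  rw [coeff_divMonomial] at he
  have := hp _ he
  simp only [Finsupp.add_apply] at this
  omega

theorem mod_Fr {n : ℕ} (i m : Fin (n + 2)) (p : SS n) (hp : p ∈ Fr m) :
    p.modMonomial (Finsupp.single i 1) ∈ Fr m := by
  rw [mem_Fr] at *
  intro e he
  by_cases h : Finsupp.single i 1 ≤ e
  · rw [coeff_modMonomial_of_le _ h] at he; exact absurd rfl he
  · rw [coeff_modMonomial_of_not_le _ h] at he; exact hp _ he

theorem mod_Fr_self {n : ℕ} (i : Fin (n + 2)) (p : SS n) :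
    p.modMonomial (Finsupp.single i 1) ∈ Fr i := by
  rw [mem_Fr]
  intro e he
  by_contra hi
  have h : Finsupp.single i 1 ≤ e := Finsupp.single_le_iff.2 (Nat.one_le_iff_ne_zero.2 hi)
  rw [coeff_modMonomial_of_le _ h] at he; exact he rfl

theorem chain_rule {n : ℕ} (φ : SS n →ₐ[ℂ] SS n) (k : Fin (n + 2)) (p : SS n) :
    pderiv k (φ p) = ∑ i, φ (pderiv i p) * pderiv k (φ (X i)) := by
  classical
  induction p using MvPolynomial.induction_on with
  | C z =>
    have : φ (C z) = C z := φ.commutes z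
    rw [this]; simp
  | add p q hp hq =>
    simp only [map_add, hp, hq, add_mul, Finset.sum_add_distrib]
  | mul_X p j hp =>
    simp only [map_mul, Derivation.leibniz, smul_eq_mul, hp, map_add, pderiv_X, add_mul,
      Finset.sum_add_distrib, Finset.mul_sum]
    congr 1
    · rw [Finset.sum_eq_single j]
      · simp
      · intro b _ hb; simp [hb.symm]
      · simp
    · exact Finset.sum_congr rfl fun i _ => by ring

theorem quasismooth_map {n : ℕ} (a : Fin (n + 2) → ℕ) (ha : ∀ i, 0 < a i) (Θ : SS n ≃ₐ[ℂ] SS n)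
    (hΘ : IsGradedAut a Θ) (f : SS n) (hq : Quasismooth f) : Quasismooth (Θ f) := by
  intro x hx hxf
  let y : Fin (n + 2) → ℂ := fun i => eval x (Θ (X i))
  have hy : ∀ p, eval y p = eval x (Θ p) := by
    intro p
    have : (aeval y : SS n →ₐ[ℂ] ℂ) = (aeval x).comp (Θ : SS n →ₐ[ℂ] SS n) := by
      apply algHom_ext; intro i
      simp [y, aeval_eq_eval]
    have := congrArg (fun g : SS n →ₐ[ℂ] ℂ => g p) this
    simpa [aeval_eq_eval] using this
  have hy' : ∀ p, eval y (Θ.symm p) = eval x p := by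
    intro p; rw [hy]; simp
  have hy0 : y ≠ 0 := by
    intro h0
    apply hx
    funext k
    have h1 := hy' (X k)
    rw [eval_X, h0] at h1
    rw [← h1]
    have h2 : (Θ.symm (X k)).IsWeightedHomogeneous a (a k) :=
      (hΘ.inv _ _).1 (isWeightedHomogeneous_X _ _ _)
    have h3 : coeff 0 (Θ.symm (X k)) = 0 := by
      apply h2.coeff_eq_zero
      simp [(ha k).ne]
    have := eval_zero (σ := Fin (n + 2)) (R := ℂ)
    rw [this]
    simpa [constantCoeff_eq] using h3
  obtain ⟨i, hi⟩ := hq y hy0 (by rw [hy, hxf])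
  by_contra hcon
  push Not at hcon
  apply hi
  have hch := chain_rule (Θ.symm : SS n →ₐ[ℂ] SS n) i (Θ f)
  have e : (Θ.symm : SS n →ₐ[ℂ] SS n) (Θ f) = f := Θ.symm_apply_apply f
  rw [e] at hch
  rw [hch, map_sum]
  refine Finset.sum_eq_zero fun k _ => ?_
  rw [map_mul]
  have : eval y ((Θ.symm : SS n →ₐ[ℂ] SS n) (pderiv k (Θ f))) = 0 := by
    rw [← hcon k]; exact hy' _
  rw [this, zero_mul]

theorem third {n : ℕ} (hn : 1 ≤ n) (i p : Fin (n + 2)) : ∃ l, l ≠ i ∧ l ≠ p := by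
  classical
  have h : ({i, p} : Finset (Fin (n + 2))).card < (Finset.univ : Finset (Fin (n + 2))).card := by
    have := Finset.card_le_two (a := i) (b := p)
    rw [Finset.card_univ, Fintype.card_fin]
    omega
  obtain ⟨l, -, hl⟩ := Finset.exists_mem_notMem_of_card_lt_card h
  simp only [Finset.mem_insert, Finset.mem_singleton, not_or] at hl
  exact ⟨l, hl⟩

theorem equiv_fix {n : ℕ} (φ : SS n ≃ₐ[ℂ] SS n) (g : SS n) (h : ∀ j, φ (X j) = X j ∨ g ∈ Fr j) :
    φ g = g := alg_fix (φ : SS n →ₐ[ℂ] SS n) g h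

theorem inf_linear {n : ℕ} (hn : 1 ≤ n) (a : Fin (n + 2) → ℕ) (ha : ∀ i, 0 < a i) (d : ℕ) (f : SS n)
    (hfh : f.IsWeightedHomogeneous a d) (j : Fin (n + 2)) (hj : coeff (Finsupp.single j 1) f ≠ 0) :
    InfData a f := by
  classical
  have hd := hfh hj
  rw [Finsupp.weight_single, one_smul] at hd
  subst hd
  obtain ⟨Θ, h1, h2, -⟩ := straighten a ha j f hfh hj
  obtain ⟨p, hp, -⟩ := third hn j j
  obtain ⟨l, hl, hlp⟩ := third hn j p
  refine ⟨Θ, h1, fun t => Function.update 1 p t, l, p, ?_, ?_, ?_⟩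
  · intro t
    rw [h2, tor_X]
    beta_reduce
    rw [Function.update_of_ne hp.symm]; simp
  · intro t; beta_reduce; rw [Function.update_of_ne hlp]; rfl
  · intro t; simp

theorem inf_const {n : ℕ} (hn : 1 ≤ n) (a : Fin (n + 2) → ℕ) (ha : ∀ i, 0 < a i) (f : SS n)
    (hfh : f.IsWeightedHomogeneous a 0) : InfData a f := by
  classical
  obtain ⟨l, hl, -⟩ := third hn (0 : Fin (n + 2)) 0
  refine ⟨1, IsGradedAut.one a, fun t => Function.update 1 0 t, l, 0, ?_, ?_, ?_⟩
  · intro t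
    refine equiv_fix _ f fun j => Or.inr ?_
    rw [mem_Fr]
    intro e he
    by_contra hj
    have h1 := hfh he
    have h2 := Finsupp.le_weight_of_ne_zero' a hj
    have := ha j
    omega
  · intro t; beta_reduce; rw [Function.update_of_ne hl]; rfl
  · intro t; simp

theorem prod_single_ne {n : ℕ} (m : Fin (n + 2)) (e : Fin (n + 2) →₀ ℕ)
    (h : ∏ i, (Pi.single m (1 : ℂ) : Fin (n + 2) → ℂ) i ^ e i ≠ 0) : e = Finsupp.single m (e m) := by
  classical
  ext i
  by_cases hi : i = m
  · subst hi; simp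
  · rw [Finsupp.single_eq_of_ne hi]
    by_contra hne
    apply h
    refine Finset.prod_eq_zero (Finset.mem_univ i) ?_
    rw [Pi.single_eq_of_ne hi, zero_pow hne]

theorem eval_single_exists {n : ℕ} (m : Fin (n + 2)) (p : SS n)
    (h : eval (Pi.single m (1 : ℂ)) p ≠ 0) : ∃ k, coeff (Finsupp.single m k) p ≠ 0 := by
  rw [eval_eq'] at h
  obtain ⟨e, he, hne⟩ := Finset.exists_ne_zero_of_sum_ne_zero h
  have := prod_single_ne m e (right_ne_zero_of_mul hne)
  refine ⟨e m, ?_⟩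
  rw [← this]
  exact mem_support_iff.1 he

theorem eval_single_coeff {n : ℕ} (a : Fin (n + 2) → ℕ) (ha : ∀ i, 0 < a i) (m : Fin (n + 2))
    (k : ℕ) (p : SS n) (hp : p.IsWeightedHomogeneous a (k * a m)) :
    eval (Pi.single m (1 : ℂ)) p = coeff (Finsupp.single m k) p := by
  classical
  rw [eval_eq', Finset.sum_eq_single (Finsupp.single m k)]
  · rw [Finset.prod_eq_one, mul_one]
    intro i _
    by_cases hi : i = m
    · subst hi; simp
    · rw [Finsupp.single_eq_of_ne hi, pow_zero]
  · intro e he hne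
    by_contra hc
    have h1 := prod_single_ne m e (right_ne_zero_of_mul hc)
    have h2 := hp (mem_support_iff.1 he)
    rw [h1, Finsupp.weight_single, smul_eq_mul] at h2
    have := Nat.eq_of_mul_eq_mul_right (ha m) h2
    rw [this] at h1
    exact hne h1
  · intro h
    rw [notMem_support_iff.1 h, zero_mul]

theorem core {n : ℕ} (hn : 1 ≤ n) (a : Fin (n + 2) → ℕ) (ha : ∀ i, 0 < a i) (d : ℕ) (hd : 0 < d)
    (f : SS n) (hfh : f.IsWeightedHomogeneous a d) (hq : Quasismooth f) (m : Fin (n + 2))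
    (hm : ∀ i, a i ≤ a m) (hdm : d ≤ 2 * a m) (hc : coeff (Finsupp.single m 2) f = 0) :
    InfData a f := by
  classical
  by_cases hlin : ∃ j, coeff (Finsupp.single j 1) f ≠ 0
  · obtain ⟨j, hj⟩ := hlin
    exact inf_linear hn a ha d f hfh j hj
  push Not at hlin
  have hev : eval (Pi.single m (1 : ℂ)) f = 0 := by
    by_contra h
    obtain ⟨k, hk⟩ := eval_single_exists m f h
    have h1 := hfh hk
    rw [Finsupp.weight_single, smul_eq_mul] at h1
    have hk2 : k ≤ 2 := Nat.le_of_mul_le_mul_right (h1.le.trans hdm) (ha m)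
    interval_cases k
    · omega
    · exact hk (hlin m)
    · exact hk hc
  obtain ⟨j, hj⟩ := hq (Pi.single m 1) (by simp) hev
  obtain ⟨k, hk⟩ := eval_single_exists m _ hj
  rw [coeff_pderiv] at hk
  have hk := left_ne_zero_of_mul hk
  have hw := hfh hk
  rw [map_add, Finsupp.weight_single, Finsupp.weight_single, one_smul, smul_eq_mul] at hw
  have haj := ha j
  have hk1 : k < 2 := by
    by_contra h
    have : 2 * a m ≤ k * a m := Nat.mul_le_mul_right _ (by omega)
    omega
  have hk0 : k ≠ 0 := by
    rintro rfl
    apply hk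
    simpa using hlin j
  have : k = 1 := by omega
  subst this
  have hjm : j ≠ m := by
    rintro rfl
    apply hk
    rw [← Finsupp.single_add]; exact hc
  rw [one_mul] at hw
  subst hw
  let L : SS n := f.divMonomial (Finsupp.single m 1)
  let h : SS n := f.modMonomial (Finsupp.single m 1)
  have hfe : f = X m * L + h := (divMonomial_add_modMonomial_single f m).symm
  have hLh : L.IsWeightedHomogeneous a (a j) := div_homog a m f _ hfh
  have hLj : coeff (Finsupp.single j 1) L ≠ 0 := by
    rw [coeff_divMonomial]; exact hk
  have hLm : L ∈ Fr m := by
    rw [mem_Fr]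
    intro e he
    by_contra hem
    have h1 := hLh he
    have h2 := Finsupp.le_weight_of_ne_zero' a hem
    have h3 := hm j
    have h4 := wt_single a ha m e (by omega) hem
    subst h4
    rw [coeff_divMonomial, ← Finsupp.single_add] at he
    exact he hc
  have hX : ∀ j, (X j : SS n).IsWeightedHomogeneous a (a j) := isWeightedHomogeneous_X _ _
  have hhh : h.IsWeightedHomogeneous a (a m + a j) := by
    have : h = f - X m * L := by rw [hfe]; ring
    rw [this]
    exact hfh.sub ((hX m).mul hLh)
  have hhm : h ∈ Fr m := mod_Fr_self m f
  obtain ⟨Θ1, g1, g2, g3, g4⟩ := straighten a ha j L hLh hLj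
  have hh1 : Θ1 h ∈ Fr m := by
    refine alg_pres (Θ1 : SS n →ₐ[ℂ] SS n) m (fun i hi => ?_) h hhm
    by_cases hij : i = j
    · subst hij; exact g4 m hjm.symm hLm
    · have : (Θ1 : SS n →ₐ[ℂ] SS n) (X i) = X i := g3 i hij
      rw [this]; exact X_mem_Fr hi
  have hh1h : (Θ1 h).IsWeightedHomogeneous a (a j + a m) := by
    rw [add_comm (a j)]; exact (g1 _ _).1 hhh
  let g : SS n := (Θ1 h).divMonomial (Finsupp.single j 1)
  let h0 : SS n := (Θ1 h).modMonomial (Finsupp.single j 1)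
  have hge : Θ1 h = X j * g + h0 := (divMonomial_add_modMonomial_single _ j).symm
  have hgh : g.IsWeightedHomogeneous a (a m) := div_homog a j _ _ hh1h
  have hgm : g ∈ Fr m := div_Fr _ _ _ hh1
  have h0m : h0 ∈ Fr m := mod_Fr _ _ _ hh1
  have h0j : h0 ∈ Fr j := mod_Fr_self _ _
  obtain ⟨Θ2, k1, k2, k3⟩ := shear a m 1 (-g) (Subalgebra.neg_mem _ hgm)
    (by rw [neg_eq_neg_one_mul, ← C_1, ← C_neg]; exact hgh.C_mul _)
  have hfix : ∀ q ∈ Fr m, Θ2 q = q := fun q hq => alg_fix (Θ2 : SS n →ₐ[ℂ] SS n) q fun i => by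
    by_cases hi : i = m
    · subst hi; exact Or.inr hq
    · exact Or.inl (k3 i hi)
  have hfin : (Θ2 * Θ1) f = X m * X j + h0 := by
    rw [AlgEquiv.mul_apply, hfe, map_add, map_mul, g2, g3 m hjm.symm, hge]
    simp only [map_add, map_mul]
    rw [hfix g hgm, hfix h0 h0m, k2, k3 j hjm]
    simp only [Units.val_one, C_1]
    ring
  obtain ⟨l, hl1, hl2⟩ := third hn m j
  refine ⟨Θ2 * Θ1, k1.mul g1, fun t => Function.update (Function.update 1 j t⁻¹) m t, l, m,
    ?_, ?_, ?_⟩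
  · intro t
    rw [hfin, map_add, map_mul, tor_X, tor_X]
    beta_reduce
    congr 1
    · rw [Function.update_self, Function.update_of_ne hjm, Function.update_self, smul_mul_smul_comm]
      simp
    · refine equiv_fix _ h0 fun i => ?_
      by_cases hi : i = m
      · subst hi; exact Or.inr h0m
      by_cases hi' : i = j
      · subst hi'; exact Or.inr h0j
      left
      rw [tor_X, Function.update_of_ne hi, Function.update_of_ne hi']
      simp
  · intro t; beta_reduce; rw [Function.update_of_ne hl1, Function.update_of_ne hl2]; rfl
  · intro t; simp

theorem find_shear {n : ℕ} (a : Fin (n + 2) → ℕ) (ha : ∀ i, 0 < a i) (m m' : Fin (n + 2))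
    (hne : m' ≠ m) (hmm : a m' = a m) (f : SS n) (hfh : f.IsWeightedHomogeneous a (2 * a m))
    (hc : coeff (Finsupp.single m' 2) f ≠ 0) :
    ∃ Θ : SS n ≃ₐ[ℂ] SS n, IsGradedAut a Θ ∧ coeff (Finsupp.single m 2) (Θ f) = 0 := by
  classical
  have hX : ∀ j, (X j : SS n).IsWeightedHomogeneous a (a j) := isWeightedHomogeneous_X _ _
  let P : SS n →ₐ[ℂ] Polynomial ℂ :=
    aeval (fun i => if i = m then 1 else if i = m' then Polynomial.X else 0)
  have hP2 : (P f).coeff 2 = coeff (Finsupp.single m' 2) f := by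
    simp only [P]
    rw [aeval_def, eval₂_eq', Polynomial.finsetSum_coeff,
      Finset.sum_eq_single (Finsupp.single m' 2)]
    · rw [Finset.prod_eq_single m']
      · simp [hne]
      · intro b _ hb; rw [Finsupp.single_eq_of_ne hb, pow_zero]
      · simp
    · intro e he hne'
      by_contra hcon
      have hprod : ∀ i, i ≠ m → i ≠ m' → e i = 0 := by
        intro i h1 h2
        by_contra hei
        apply hcon
        rw [Finset.prod_eq_zero (Finset.mem_univ i), mul_zero, Polynomial.coeff_zero]
        simp [h1, h2, hei]
      have hpr : ∏ i, (if i = m then 1 else if i = m' then Polynomial.X else (0 : Polynomial ℂ)) ^ e i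
          = Polynomial.X ^ e m' := by
        rw [Finset.prod_eq_single m']
        · simp [hne]
        · intro b _ hb
          by_cases hbm : b = m
          · simp [hbm]
          · rw [hprod b hbm hb, pow_zero]
        · simp
      rw [hpr, Polynomial.algebraMap_eq, Polynomial.coeff_C_mul, Polynomial.coeff_X_pow] at hcon
      have h2 : 2 = e m' := by
        by_contra h
        rw [if_neg h, mul_zero] at hcon
        exact hcon rfl
      have hw := hfh (mem_support_iff.1 he)
      rw [Finsupp.weight_apply, Finsupp.sum_fintype _ _ (by simp),
        ← Finset.add_sum_erase _ _ (Finset.mem_univ m'),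
        ← Finset.add_sum_erase _ _ (Finset.mem_erase.2 ⟨hne.symm, Finset.mem_univ m⟩)] at hw
      rw [← h2, hmm, smul_eq_mul, smul_eq_mul] at hw
      have hem : e m = 0 := by
        have : e m * a m = 0 := by omega
        rcases Nat.mul_eq_zero.1 this with h | h
        · exact h
        · exact absurd h (ha m).ne'
      apply hne'
      ext i
      by_cases hi' : i = m'
      · subst hi'; simp [h2]
      rw [Finsupp.single_eq_of_ne hi']
      by_cases hi : i = m
      · rw [hi, hem]
      · exact hprod i hi hi'
    · intro h; rw [notMem_support_iff.1 h]; simp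
  have hdeg : (P f).degree ≠ 0 := by
    intro h
    have h2 := Polynomial.eq_C_of_degree_eq_zero h
    rw [h2, Polynomial.coeff_C] at hP2
    exact hc (by simpa using hP2.symm)
  obtain ⟨s, hs⟩ := IsAlgClosed.exists_root (P f) hdeg
  obtain ⟨Θ, h1, h2, h3⟩ := shear a m' 1 (C s * X m)
    (Subalgebra.mul_mem _ (C_mem_Fr _) (X_mem_Fr hne.symm)) (by rw [hmm]; exact (hX m).C_mul _)
  refine ⟨Θ, h1, ?_⟩
  rw [← eval_single_coeff a ha m 2 _ ((h1 _ _).1 hfh)]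
  have hcomp : ((aeval (Pi.single m (1 : ℂ)) : SS n →ₐ[ℂ] ℂ)).comp (Θ : SS n →ₐ[ℂ] SS n) =
      (Polynomial.aeval s).comp P := by
    apply algHom_ext
    intro i
    change aeval (Pi.single m (1 : ℂ)) (Θ (X i)) = Polynomial.aeval s (P (X i))
    by_cases hi' : i = m'
    · subst hi'
      rw [h2]
      simp [P, hne]
    · rw [h3 i hi']
      by_cases hi : i = m
      · subst hi; simp [P]
      · simp [P, hi, hi']
  have := congrArg (fun g : SS n →ₐ[ℂ] ℂ => g f) hcomp
  have h5 : aeval (Pi.single m (1 : ℂ)) (Θ f) = Polynomial.aeval s (P f) := this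
  rw [aeval_eq_eval] at h5
  change eval _ _ = _ at h5
  rw [h5, Polynomial.coe_aeval_eq_eval]
  exact hs

theorem infinite_dir {n : ℕ} (hn : 1 ≤ n) (a : Fin (n + 2) → ℕ) (ha : ∀ i, 0 < a i) (d : ℕ)
    (f : SS n) (hfh : f.IsWeightedHomogeneous a d) (hq : Quasismooth f) (hc : ¬ FinCond a d) :
    InfData a f := by
  classical
  rcases Nat.eq_zero_or_pos d with hd | hd
  · subst hd; exact inf_const hn a ha f hfh
  obtain ⟨m, -, hm⟩ := Finset.exists_mem_eq_sup (Finset.univ : Finset (Fin (n + 2)))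
    Finset.univ_nonempty a
  have hle : ∀ i, a i ≤ a m := fun i => hm ▸ Finset.le_sup (Finset.mem_univ i)
  rw [FinCond, hm] at hc
  push Not at hc
  obtain ⟨hdm, hc⟩ := hc
  by_cases hmc : coeff (Finsupp.single m 2) f = 0
  · exact core hn a ha d hd f hfh hq m hle hdm hmc
  have hw := hfh hmc
  rw [Finsupp.weight_single, smul_eq_mul] at hw
  subst hw
  obtain ⟨m', hm', hne⟩ : ∃ m', a m' = a m ∧ m' ≠ m := by
    by_contra hcon
    push Not at hcon
    exact hc rfl ⟨m, rfl, hcon⟩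
  obtain ⟨Θ, h1, h2⟩ := find_shear a ha m' m hne.symm hm'.symm f (by rw [hm']; exact hfh) hmc
  refine InfData.comp Θ h1 ?_
  exact core hn a ha _ hd (Θ f) ((h1 _ _).1 hfh) (quasismooth_map a ha Θ h1 f hq) m'
    (by rw [hm']; exact hle) (by rw [hm']) h2

theorem main_iff {n : ℕ} (hn : 1 ≤ n) (a : Fin (n + 2) → ℕ) (ha : ∀ i, 0 < a i) (d : ℕ)
    (f : SS n) (hfh : f.IsWeightedHomogeneous a d) (hq : Quasismooth f) :
    Finite (linGroup a f ⧸ (diagSubgroup a).subgroupOf (linGroup a f)) ↔ FinCond a d := by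
  constructor
  · intro h
    by_contra hc
    exact conj_infinite a ha f (infinite_dir hn a ha d f hfh hq hc) h
  · exact finite_dir a ha d f hfh hq

/-- For a quasismooth hypersurface `{f = 0}` of degree `d` in a well-formed
weighted projective space with `n ≥ 1`, the linear automorphism group `Lin(X) = G_f/Δ` is
finite if and only if `d > 2·max aᵢ`, or `d = 2·max aᵢ` and exactly one weight attains
the maximum. -/
theorem lin_finite_iff {n : ℕ} (hn : 1 ≤ n) (a : Fin (n + 2) → ℕ) (ha : ∀ i, 0 < a i)
    (hwf : WellFormed a) (d : ℕ) (f : MvPolynomial (Fin (n + 2)) ℂ) (hf0 : f ≠ 0)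
    (hfh : f.IsWeightedHomogeneous a d) (hq : Quasismooth f) :
    Finite (linGroup a f ⧸ (diagSubgroup a).subgroupOf (linGroup a f)) ↔
      (2 * Finset.univ.sup a < d ∨
        (d = 2 * Finset.univ.sup a ∧ ∃! i, a i = Finset.univ.sup a)) := by
  exact main_iff hn a ha d f hfh hq

end
end

section
/- Let f ∈ S be a nonzero weighted-homogeneous quasismooth polynomial of degree d, and assume either d > 2·max{a_0,…,a_{n+1}}, or d = 2·max{a_0,…,a_{n+1}} with exactly one weight attaining the maximum. Suppose z_0,…,z_{n+1} ∈ S with each z_i weighted-homogeneous of degree a_i and c ∈ ℂ satisfy Σ_{i} z_i·(∂f/∂x_i) = c·f. Then z_i = (c·a_i/d)·x_i for every i. -/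
open MvPolynomial

noncomputable section

def ksg {N : ℕ} (R : Type) [CommRing R] (j : Fin N) (A : Finset (Fin N)) : R :=
  (-1) ^ (A.filter (· < j)).card

def kd {N : ℕ} {R : Type} [CommRing R] (f : Fin N → R) (u : Finset (Fin N) → R)
    (A : Finset (Fin N)) : R :=
  ∑ j, if j ∉ A then ksg R j A * f j * u (insert j A) else 0

def kw {N : ℕ} {R : Type} [CommRing R] (c : Fin N → R) (u : Finset (Fin N) → R)
    (A : Finset (Fin N)) : R :=
  ∑ j, if j ∈ A then ksg R j A * c j * u (A.erase j) else 0

section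
variable {N : ℕ} {R : Type} [CommRing R]

lemma ksg_insert (j k : Fin N) (A : Finset (Fin N)) (h : k ∉ A) :
    ksg R j (insert k A) = ksg R j A * (if k < j then -1 else 1) := by
  unfold ksg
  rw [Finset.filter_insert]
  split_ifs with hk
  · rw [Finset.card_insert_of_notMem (by simp [h]), pow_succ]
  · simp

lemma ksg_self (j : Fin N) (A : Finset (Fin N)) : ksg R j A * ksg R j A = 1 := by
  unfold ksg
  rw [← pow_add, ← two_mul]; simp

lemma kd_kd [IsDomain R] [CharZero R] (f : Fin N → R) (u : Finset (Fin N) → R)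
    (A : Finset (Fin N)) : kd f (kd f u) A = 0 := by
  have key : kd f (kd f u) A = - kd f (kd f u) A := by
    conv_rhs => unfold kd
    conv_lhs => unfold kd
    simp only [Finset.mul_sum, ← Finset.sum_neg_distrib]
    have e : ∀ (p : Prop) [Decidable p] (F : Fin N → R),
        (if p then ∑ k, F k else 0) = ∑ k, if p then F k else 0 := by
      intro p _ F; split_ifs <;> simp
    simp only [e, ← Finset.sum_neg_distrib]
    rw [Finset.sum_comm]
    refine Finset.sum_congr rfl fun j _ => Finset.sum_congr rfl fun k _ => ?_
    by_cases hj : j ∈ A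
    · simp [hj]
    by_cases hk : k ∈ A
    · simp [hk]
    by_cases hjk : j = k
    · subst hjk; simp
    have hkj : ¬ k = j := fun h => hjk h.symm
    simp only [hj, hk, hjk, hkj, Finset.mem_insert, not_false_eq_true, if_true, or_self]
    rw [ksg_insert _ _ _ hk, ksg_insert _ _ _ hj, Finset.insert_comm]
    rcases lt_or_gt_of_ne hjk with h | h
    · simp only [h, h.not_gt, if_true, if_false]; ring
    · simp only [h, h.not_gt, if_true, if_false]; ring
  exact self_eq_neg.mp key

lemma kd_kw (f c : Fin N → R) (u : Finset (Fin N) → R) (A : Finset (Fin N)) :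
    kd f (kw c u) A + kw c (kd f u) A = (∑ j, c j * f j) * u A := by
  unfold kd kw
  simp only [Finset.mul_sum]
  have e : ∀ (p : Prop) [Decidable p] (F : Fin N → R),
      (if p then ∑ k, F k else 0) = ∑ k, if p then F k else 0 := by
    intro p _ F; split_ifs <;> simp
  simp only [e]
  rw [Finset.sum_comm (γ := Fin N)]
  rw [← Finset.sum_add_distrib]
  simp only [← Finset.sum_add_distrib, Finset.sum_mul]
  refine Finset.sum_congr rfl fun k _ => ?_
  rw [Finset.sum_eq_single k]
  · by_cases hk : k ∈ A
    · have := ksg_self (R := R) k (A.erase k)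
      have h2 := ksg_insert (R := R) k k (A.erase k) (by simp)
      rw [Finset.insert_erase hk] at h2
      simp only [hk, Finset.mem_erase, Finset.insert_erase hk, h2]
      simp
      linear_combination c k * f k * u A * this
    · have := ksg_self (R := R) k A
      have h2 := ksg_insert (R := R) k k A hk
      simp [hk, h2]
      linear_combination c k * f k * u A * this
  · intro j _ hjk
    have hkj : ¬ k = j := fun h => hjk h.symm
    by_cases hk : k ∈ A
    · by_cases hj : j ∈ A
      · simp [hj, hk, hjk]
      · obtain ⟨B, hB, rfl⟩ : ∃ B, k ∉ B ∧ A = insert k B :=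
          ⟨A.erase k, by simp, (Finset.insert_erase hk).symm⟩
        have hjB : j ∉ B := fun h => hj (Finset.mem_insert_of_mem h)
        have h1 : (insert j (insert k B)).erase k = insert j B := by
          rw [Finset.insert_comm, Finset.erase_insert]
          simp [hB, hkj]
        simp only [hj, h1, Finset.erase_insert hB, hjB]
        rw [ksg_insert k j _ hj, ksg_insert j k _ hB]
        simp only [Finset.mem_insert, true_or, or_true, if_true, not_false_eq_true]
        rcases lt_or_gt_of_ne hjk with h | h
        · simp only [h, h.not_gt, if_true, if_false]; ring
        · simp only [h, h.not_gt, if_true, if_false]; ring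
    · simp [hk, hkj]
  · simp

lemma kd_mem (I : Ideal R) (f : Fin N → R) (u : Finset (Fin N) → R) (h : ∀ A, u A ∈ I)
    (A : Finset (Fin N)) : kd f u A ∈ I := by
  unfold kd
  refine Ideal.sum_mem _ fun j _ => ?_
  split_ifs
  · exact I.zero_mem
  · exact I.mul_mem_left _ (h _)

lemma kw_mem (I : Ideal R) (f : Fin N → R) (u : Finset (Fin N) → R) (h : ∀ A, u A ∈ I)
    (A : Finset (Fin N)) : kw f u A ∈ I := by
  unfold kw
  refine Ideal.sum_mem _ fun j _ => ?_
  split_ifs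
  · exact I.mul_mem_left _ (h _)
  · exact I.zero_mem

/-- Koszul acyclicity in depth form. -/
lemma koszul [IsDomain R] [CharZero R] (f : Fin N → R) (g : ℕ → R) (G : ℕ → Ideal R)
    (hg : ∀ r < N, ∃ c : Fin N → R, g r = ∑ j, c j * f j)
    (hG : ∀ r < N, ∀ x, x ∈ G (r + 1) ↔ ∃ s, x - g r * s ∈ G r)
    (hreg : ∀ r < N, ∀ x, g r * x ∈ G r → x ∈ G r)
    (t : ℕ) : ∀ (r i : ℕ), r + t = N → i = r + 1 → ∀ u : Finset (Fin N) → R,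
      (∀ A, A.card ≠ i → u A = 0) → (∀ A, kd f u A ∈ G r) →
      ∃ v, ∀ A, u A - kd f v A ∈ G r := by
  induction t with
  | zero =>
    intro r i hr hi u hu _
    refine ⟨0, fun A => ?_⟩
    have : u A = 0 := hu A (by have := Finset.card_le_univ A; simp at this; omega)
    simp [this, kd]
  | succ t ih =>
    intro r i hr hi u hu hcyc
    have hrN : r < N := by omega
    obtain ⟨c, hc⟩ := hg r hrN
    have hv : ∀ A, kd f (kw c u) A - g r * u A ∈ G r := by
      intro A
      have := kd_kw f c u A
      rw [← hc] at this
      have h2 : kd f (kw c u) A - g r * u A = - kw c (kd f u) A := by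
        linear_combination this
      rw [h2]
      exact (G r).neg_mem (kw_mem _ _ _ hcyc A)
    obtain ⟨w, hw⟩ := ih (r + 1) (i + 1) (by omega) (by omega) (kw c u) (by
      intro A hA
      unfold kw
      refine Finset.sum_eq_zero fun j _ => ?_
      split_ifs with hj
      · rw [hu (A.erase j), mul_zero]
        have := Finset.card_erase_add_one hj
        omega
      · rfl) (by
      intro A
      rw [hG r hrN]
      exact ⟨u A, hv A⟩)
    simp only [hG r hrN] at hw
    choose s hs using hw
    refine ⟨s, fun A => hreg r hrN _ ?_⟩
    have h3 := kd_mem (G r) f _ hs A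
    have h4 : kd f (fun A => kw c u A - kd f w A - g r * s A) A =
        kd f (kw c u) A - kd f (kd f w) A - g r * kd f s A := by
      unfold kd
      rw [Finset.mul_sum, ← Finset.sum_sub_distrib, ← Finset.sum_sub_distrib]
      refine Finset.sum_congr rfl fun j _ => ?_
      split_ifs <;> ring
    rw [h4, kd_kd] at h3
    have := (G r).sub_mem h3 (hv A)
    convert this using 1
    ring
end

section
variable {N : ℕ}

def mG (N : ℕ) (k : ℕ) (r : ℕ) : Ideal (MvPolynomial (Fin N) ℂ) :=
  Ideal.span ((fun s => monomial s (1 : ℂ)) ''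
    ((fun j : Fin N => Finsupp.single j k) '' {j | j.val < r}))

lemma mem_mG (k r : ℕ) (x : MvPolynomial (Fin N) ℂ) :
    x ∈ mG N k r ↔ ∀ m ∈ x.support, ∃ j : Fin N, j.val < r ∧ k ≤ m j := by
  unfold mG
  rw [mem_ideal_span_monomial_image]
  simp

lemma mG_zero (k : ℕ) : mG N k 0 = ⊥ := by simp [mG]

lemma mG_succ (k r : ℕ) (hr : r < N) (x : MvPolynomial (Fin N) ℂ) :
    x ∈ mG N k (r + 1) ↔ ∃ s, x - X ⟨r, hr⟩ ^ k * s ∈ mG N k r := by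
  have h : mG N k (r + 1) = Ideal.span {X ⟨r, hr⟩ ^ k} ⊔ mG N k r := by
    unfold mG
    rw [← Ideal.span_union]
    congr 1
    have : {j : Fin N | j.val < r + 1} = {⟨r, hr⟩} ∪ {j | j.val < r} := by
      ext j; simp [Fin.ext_iff]; omega
    rw [this, Set.image_union, Set.image_union]
    simp [X_pow_eq_monomial]
  rw [h, Submodule.mem_sup]
  constructor
  · rintro ⟨y, hy, z, hz, rfl⟩
    obtain ⟨s, rfl⟩ := Ideal.mem_span_singleton'.mp hy
    exact ⟨s, by convert hz using 1; ring⟩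
  · rintro ⟨s, hs⟩
    generalize (X ⟨r, hr⟩ ^ k : MvPolynomial (Fin N) ℂ) = y at hs ⊢
    have h1 : y * s ∈ Ideal.span {y} := Ideal.mem_span_singleton'.mpr ⟨s, mul_comm s y⟩
    exact ⟨y * s, h1, x - y * s, hs, add_sub_cancel (y * s) x⟩

lemma mG_reg (k r : ℕ) (hr : r < N) (x : MvPolynomial (Fin N) ℂ)
    (h : X ⟨r, hr⟩ ^ k * x ∈ mG N k r) : x ∈ mG N k r := by
  rw [mem_mG] at h ⊢
  intro m hm
  obtain ⟨j, hj, hk⟩ := h (Finsupp.single ⟨r, hr⟩ k + m) (by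
    rw [mem_support_iff, X_pow_eq_monomial, coeff_monomial_mul]
    simpa using hm)
  refine ⟨j, hj, ?_⟩
  have hne : (⟨r, hr⟩ : Fin N) ≠ j := by
    intro h
    have := congrArg Fin.val h
    simp only at this
    omega
  rw [Finsupp.add_apply, Finsupp.single_apply, if_neg hne, zero_add] at hk
  exact hk

lemma first_syzygy (f w : Fin N → MvPolynomial (Fin N) ℂ)
    (hz : ∀ x : Fin N → ℂ, (∀ j, eval x (f j) = 0) → x = 0)
    (hw : ∑ j, f j * w j = 0) (i : Fin N) : ∃ h : Fin N → MvPolynomial (Fin N) ℂ,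
      w i = ∑ j, h j * f j := by
  have hrad : ∀ j : Fin N, X j ∈ (Ideal.span (Set.range f)).radical := by
    intro j
    rw [← vanishingIdeal_zeroLocus_eq_radical (K := ℂ), mem_vanishingIdeal_iff]
    intro x hx
    have : x = 0 := hz x fun l => by
      have := hx (f l) (Ideal.subset_span ⟨l, rfl⟩)
      simpa [aeval_eq_eval] using this
    simp [this]
  choose e he using hrad
  have hk : ∀ j : Fin N, X j ^ (∑ l, e l) ∈ Ideal.span (Set.range f) := fun j =>
    Ideal.pow_mem_of_pow_mem _ (he j) (Finset.single_le_sum (f := e) (by simp) (Finset.mem_univ j))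
  set k := ∑ l, e l
  let g : ℕ → MvPolynomial (Fin N) ℂ := fun r => if hr : r < N then X ⟨r, hr⟩ ^ k else 0
  obtain ⟨v, hv⟩ := koszul f g (mG N k)
    (by
      intro r hr
      obtain ⟨c, hc⟩ := Ideal.mem_span_range_iff_exists_fun.mp (hk ⟨r, hr⟩)
      exact ⟨c, by simp [g, hr, hc]⟩)
    (by intro r hr x; simp only [g, hr, dif_pos]; exact mG_succ k r hr x)
    (by intro r hr x; simp only [g, hr, dif_pos]; exact mG_reg k r hr x)
    N 0 1 (by simp) rfl (fun A => ∑ j, if A = {j} then w j else 0)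
    (by
      intro A hA
      refine Finset.sum_eq_zero fun j _ => ?_
      rw [if_neg]
      rintro rfl
      simp at hA)
    (by
      intro A
      have : kd f (fun A => ∑ j, if A = {j} then w j else 0) A = 0 := by
        unfold kd
        by_cases hA : A = ∅
        · subst hA
          simpa [ksg] using hw
        · refine Finset.sum_eq_zero fun j _ => ?_
          split_ifs with hj
          · rfl
          · have : (∑ l, if insert j A = {l} then w l else 0) = 0 := by
              refine Finset.sum_eq_zero fun l _ => ?_
              rw [if_neg]
              intro h
              have h1 := congrArg Finset.card h
              rw [Finset.card_insert_of_notMem hj] at h1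
              simp at h1
              exact hA h1
            beta_reduce
            rw [this, mul_zero]
      rw [this]; exact Ideal.zero_mem _)
  have h := hv {i}
  rw [mG_zero, Ideal.mem_bot, sub_eq_zero] at h
  refine ⟨fun j => if j ∉ ({i} : Finset (Fin N)) then ksg _ j {i} * v (insert j {i}) else 0, ?_⟩
  have h2 : (∑ j, if ({i} : Finset (Fin N)) = {j} then w j else 0) = w i := by simp
  rw [← h2, h]
  unfold kd
  refine Finset.sum_congr rfl fun j _ => ?_
  by_cases hj : j ∈ ({i} : Finset (Fin N))
  · simp only [hj, not_true_eq_false, if_false, zero_mul]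
  · simp only [hj, not_false_eq_true, if_true]; ring

lemma low_degree {a : Fin N → ℕ} {f h : Fin N → MvPolynomial (Fin N) ℂ} {e : Fin N → ℕ}
    (hf : ∀ j, (f j).IsWeightedHomogeneous a (e j)) {p : MvPolynomial (Fin N) ℂ} {b : ℕ}
    (hp : p.IsWeightedHomogeneous a b) (hb : ∀ j, b < e j) (hh : p = ∑ j, h j * f j) :
    p = 0 := by
  ext m
  rw [coeff_zero]
  by_contra hm
  have hwt := hp hm
  apply hm
  rw [hh, coeff_sum]
  refine Finset.sum_eq_zero fun j _ => ?_
  rw [coeff_mul]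
  refine Finset.sum_eq_zero fun q hq => ?_
  rw [Finset.HasAntidiagonal.mem_antidiagonal] at hq
  by_contra hne
  have := hf j (right_ne_zero_of_mul hne)
  rw [← hq, map_add, this] at hwt
  have := hb j
  omega
end

/-- For a quasismooth `f` of degree `d` with `d > 2·max aᵢ`, or
`d = 2·max aᵢ` with a unique maximal weight: any relation `Σ zᵢ·∂f/∂xᵢ = c·f` with each `zᵢ`
weighted-homogeneous of degree `aᵢ` forces `zᵢ = (c·aᵢ/d)·xᵢ` for every `i`. -/
theorem infinitesimal_automorphisms_trivial {n : ℕ} (a : Fin (n + 2) → ℕ) (ha : ∀ i, 0 < a i)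
    (d : ℕ) (f : MvPolynomial (Fin (n + 2)) ℂ) (hf0 : f ≠ 0)
    (hfh : f.IsWeightedHomogeneous a d) (hq : Quasismooth f)
    (hd : 2 * Finset.univ.sup a < d ∨
      (d = 2 * Finset.univ.sup a ∧ ∃! i, a i = Finset.univ.sup a))
    (z : Fin (n + 2) → MvPolynomial (Fin (n + 2)) ℂ)
    (hz : ∀ i, (z i).IsWeightedHomogeneous a (a i)) (c : ℂ)
    (hrel : ∑ i, z i * pderiv i f = c • f) :
    ∀ i, z i = ((c * (a i : ℂ)) / (d : ℂ)) • X i := by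
  have hle : ∀ i, a i ≤ Finset.univ.sup a := fun i => Finset.le_sup (Finset.mem_univ i)
  have hd2 : 2 * Finset.univ.sup a ≤ d := by omega
  have hd0 : 0 < d := by have := hle 0; have := ha 0; omega
  have hdC : (d : ℂ) ≠ 0 := by exact_mod_cast hd0.ne'
  have heuler := hfh.sum_weight_X_mul_pderiv
  have hph : ∀ j, (pderiv j f).IsWeightedHomogeneous a (d - a j) := fun j =>
    hfh.pderiv (by have := hle j; omega)
  have hzero : ∀ x : Fin (n + 2) → ℂ, (∀ j, eval x (pderiv j f) = 0) → x = 0 := by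
    intro x hx
    by_contra hx0
    have h1 := congrArg (eval x) heuler
    have h2 : eval x f = 0 := by
      simpa [hx, hdC, hd0.ne'] using h1
    obtain ⟨i, hi⟩ := hq x hx0 h2
    exact hi (hx i)
  set w : Fin (n + 2) → MvPolynomial (Fin (n + 2)) ℂ :=
    fun i => z i - ((c * (a i : ℂ)) / (d : ℂ)) • X i with hwdef
  have hwh : ∀ i, (w i).IsWeightedHomogeneous a (a i) := fun i =>
    (weightedHomogeneousSubmodule ℂ a (a i)).sub_mem (hz i)
      ((weightedHomogeneousSubmodule ℂ a (a i)).smul_mem _ (isWeightedHomogeneous_X ℂ a i))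
  have hsyz : ∑ j, pderiv j f * w j = 0 := by
    have h1 : ∑ j, pderiv j f * w j = ∑ j, z j * pderiv j f
        - (c / d) • ∑ j, a j • (X j * pderiv j f) := by
      rw [Finset.smul_sum, ← Finset.sum_sub_distrib]
      refine Finset.sum_congr rfl fun j _ => ?_
      simp only [hwdef, smul_eq_C_mul, nsmul_eq_mul]
      have : (C (c * (a j : ℂ) / d) : MvPolynomial (Fin (n + 2)) ℂ) = C (c / d) * (a j : MvPolynomial (Fin (n + 2)) ℂ) := by
        rw [← map_natCast (C : ℂ →+* MvPolynomial (Fin (n + 2)) ℂ), ← C_mul]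
        congr 1; ring
      rw [this]; ring
    rw [h1, hrel, heuler, ← Nat.cast_smul_eq_nsmul ℂ, smul_smul, div_mul_cancel₀ _ hdC, sub_self]
  suffices hw0 : ∀ i, w i = 0 from fun i => sub_eq_zero.mp (hw0 i)
  have hlow : ∀ i, (∀ j, a i < d - a j) → w i = 0 := by
    intro i hi
    obtain ⟨h, hh⟩ := first_syzygy _ _ hzero hsyz i
    exact low_degree hph (hwh i) hi hh
  rcases hd with hd | ⟨hd, m, hm, hm'⟩
  · intro i
    refine hlow i fun j => ?_
    have := hle i; have := hle j; omega
  · have hne : ∀ i, i ≠ m → w i = 0 := by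
      intro i hi
      refine hlow i fun j => ?_
      have := hle i; have := hle j
      have : a i ≠ Finset.univ.sup a := fun h => hi (hm' i h)
      omega
    intro i
    by_cases hi : i = m
    · subst hi
      rw [Finset.sum_eq_single i (fun j _ hj => by rw [hne j hj, mul_zero]) (by simp)] at hsyz
      refine (mul_eq_zero.mp hsyz).resolve_left fun hfi => ?_
      obtain ⟨h, hh⟩ := first_syzygy (fun j => pderiv j f) (Pi.single i 1) hzero (by
        refine Finset.sum_eq_zero fun j _ => ?_
        by_cases hj : j = i
        · subst hj; rw [hfi, zero_mul]
        · simp [hj]) i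
      have := low_degree hph (p := 1) (b := 0) (isWeightedHomogeneous_one ℂ a)
        (fun j => by have := hle j; have := ha j; omega) (by simpa using hh)
      exact one_ne_zero this
    · exact hne i hi

end
end
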